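/- arXiv:1810.01563 — 3 statements merged into one kernel-verified Lean document; each statement's English description precedes it below -/
import Mathlib

section
/- Let L ⊆ ℤ^{s+t+1} be a p/q-changemaker lattice with q > 1. Suppose v ∈ L is irreducible and unbreakable, v·f_i ≠ 0 for some i, and v·f_0 = 0. Then there exist indices 1 ≤ a ≤ b ≤ m−1 and a sign ε ∈ {1, −1} such that ε·v = μ_a + μ_{a+1} + … + μ_b, and there is at most one index c with a ≤ c ≤ b and μ_c·μ_c > 2 (i.e. μ_i·μ_i = 2 for all but at most one i in the range a ≤ i ≤ b). -/
/-- The negative continued fraction `[a_0, …, a_{n-1}]⁻ = a_0 − 1/[a_1, …, a_{n-1}]⁻`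
(with junk value `1` for the empty list). -/
def negCF : (ℕ → ℤ) → ℕ → ℚ
  | _, 0 => 1
  | a, 1 => a 0
  | a, n + 2 => (a 0 : ℚ) - 1 / negCF (fun i => a (i + 1)) (n + 1)

/-- A nondecreasing tuple `(σ_1, …, σ_t)` of positive integers (here `σ i` for `i < t`
represents `σ_{i+1}`) satisfies the changemaker condition if every integer `n` with
`1 ≤ n ≤ σ_1 + … + σ_t` is a sum of the `σ_i` over some subset of indices. -/
def Changemaker (t : ℕ) (σ : ℕ → ℤ) : Prop :=
  ∀ n : ℤ, 1 ≤ n → n ≤ ∑ i ∈ Finset.range t, σ i →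
    ∃ A : Finset ℕ, A ⊆ Finset.range t ∧ n = ∑ i ∈ A, σ i

/-- The ambient lattice `ℤ^{s+t+1}` with orthonormal basis `f_0, …, f_s`
(coordinates `Sum.inl i`) and `e_1, …, e_t` (coordinate `Sum.inr i` represents
`e_{i+1}`), with its standard inner product. -/
def cmInner {s t : ℕ} (x y : Fin (s + 1) ⊕ Fin t → ℤ) : ℤ :=
  ∑ j, x j * y j

/-- The defining vectors of a changemaker lattice:
`w_0 = f_0 + σ_1 e_1 + … + σ_t e_t` and, for `1 ≤ k ≤ l`,
`w_k = −f_{α_{k−1}} + f_{α_{k−1}+1} + … + f_{α_k}`. -/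
def cmW (s t : ℕ) (σ : ℕ → ℤ) (α : ℕ → ℕ) : ℕ → Fin (s + 1) ⊕ Fin t → ℤ
  | 0 => fun j => match j with
      | Sum.inl i => if i.val = 0 then 1 else 0
      | Sum.inr i => σ i.val
  | k + 1 => fun j => match j with
      | Sum.inl i =>
          if i.val = α k then -1
          else if α k < i.val ∧ i.val ≤ α (k + 1) then 1 else 0
      | Sum.inr _ => 0

/-- The `p/q`-changemaker lattice `L = ⟨w_0, …, w_l⟩^⊥ ⊆ ℤ^{s+t+1}`. -/
def cmLattice (s t l : ℕ) (σ : ℕ → ℤ) (α : ℕ → ℕ) : Set (Fin (s + 1) ⊕ Fin t → ℤ) :=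
  {x | ∀ k ≤ l, cmInner x (cmW s t σ α k) = 0}

/-- The vectors `μ_0 = f_0 + … + f_{β_1}` and, for `k ≥ 1`,
`μ_k = −f_{β_k} + f_{β_k+1} + … + f_{β_{k+1}}`. -/
def cmMu (s t : ℕ) (β : ℕ → ℕ) : ℕ → Fin (s + 1) ⊕ Fin t → ℤ
  | 0 => fun j => match j with
      | Sum.inl i => if i.val ≤ β 1 then 1 else 0
      | Sum.inr _ => 0
  | k + 1 => fun j => match j with
      | Sum.inl i =>
          if i.val = β (k + 1) then -1
          else if β (k + 1) < i.val ∧ i.val ≤ β (k + 2) then 1 else 0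
      | Sum.inr _ => 0

/-- The standard basis vectors `ν_1, …, ν_t` (here `cmNu … k` for `k < t` represents
`ν_{k+1}`, with `e`-indices shifted down by one):  if `σ_{k+1}` is tight then
`ν_{k+1} = −e_{k+1} + e_k + … + e_1 + μ_0`, and otherwise
`ν_{k+1} = −e_{k+1} + Σ_{i ∈ A_{k+1}} e_i`, where `A` records the lexicographically
maximal subsets. -/
def cmNu (s t : ℕ) (σ : ℕ → ℤ) (β : ℕ → ℕ) (A : ℕ → Finset ℕ) (k : ℕ) :
    Fin (s + 1) ⊕ Fin t → ℤ :=
  if σ k = 1 + ∑ i ∈ Finset.range k, σ i then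
    fun j => match j with
      | Sum.inl i => if i.val ≤ β 1 then 1 else 0
      | Sum.inr i => if i.val = k then -1 else if i.val < k then 1 else 0
  else
    fun j => match j with
      | Sum.inl _ => 0
      | Sum.inr i => if i.val = k then -1 else if i.val ∈ A k then 1 else 0

open Classical in
/-- scalar coordinates attached to a height function -/
noncomputable def xs (P : ℕ → Prop) (h : ℕ → ℤ) (n : ℕ) : ℤ :=
  if P n then h n - h (n + 1) else h n

/-- vector supported on the `f` coordinates -/
def fvec (s t : ℕ) (u : ℕ → ℤ) : Fin (s + 1) ⊕ Fin t → ℤ :=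
  Sum.elim (fun i => u i.val) (fun _ => 0)

lemma fvec_inner (s t : ℕ) (u w : ℕ → ℤ) :
    cmInner (fvec s t u) (fvec s t w) = ∑ n ∈ Finset.range (s + 1), u n * w n := by
  simp [cmInner, fvec, Fintype.sum_sum_type, Finset.sum_range]

lemma fvec_add (s t : ℕ) (P : ℕ → Prop) (h k : ℕ → ℤ) :
    fvec s t (xs P (h + k)) = fvec s t (xs P h) + fvec s t (xs P k) := by
  funext j
  rcases j with j | j
  · simp only [fvec, xs, Sum.elim_inl, Pi.add_apply]
    split_ifs <;> ring
  · simp [fvec]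

structure Adm (s : ℕ) (P : ℕ → Prop) (h : ℕ → ℤ) : Prop where
  zero : h 0 = 0
  one : h 1 = 0
  big : ∀ n, s < n → h n = 0
  step : ∀ n, n ≤ s → ¬ P n → h (n + 1) = h n

lemma adm_zero {s t : ℕ} {P : ℕ → Prop} {h : ℕ → ℤ} (hh : Adm s P h)
    (h0 : fvec s t (xs P h) = 0) : ∀ n, h n = 0 := by
  have key : ∀ n, n ≤ s → h n = 0 := by
    intro n
    induction n with
    | zero => intro _; exact hh.zero
    | succ n ih =>
      intro hn
      have h1 := ih (by omega)
      have h2 := congrFun h0 (Sum.inl ⟨n, by omega⟩)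
      simp only [fvec, xs, Sum.elim_inl, Pi.zero_apply] at h2
      by_cases hP : P n
      · rw [if_pos hP] at h2; omega
      · rw [hh.step n (by omega) hP, h1]
  intro n
  by_cases hn : n ≤ s
  · exact key n hn
  · exact hh.big n (by omega)

/-- inner product of the two halves of a cut -/
lemma cut_inner {s t : ℕ} {P : ℕ → Prop} (h : ℕ → ℤ) (N : ℕ) (hN : N ≤ s) (hP : P N) :
    cmInner (fvec s t (xs P (fun n => if n ≤ N then h n else 0)))
      (fvec s t (xs P (fun n => if n ≤ N then 0 else h n))) = - (h N * h (N + 1)) := by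
  rw [fvec_inner, Finset.sum_eq_single N]
  · simp [xs, hP]
  · intro n _ hn
    rcases lt_or_gt_of_ne hn with h1 | h1
    · have e1 : n ≤ N := by omega
      have e2 : n + 1 ≤ N := by omega
      simp [xs, e1, e2]
    · have e1 : ¬ n ≤ N := by omega
      have e2 : ¬ n + 1 ≤ N := by omega
      simp [xs, e1, e2]
  · intro h1; simp at h1; omega

lemma cut_adm {s : ℕ} {P : ℕ → Prop} {h : ℕ → ℤ} (hh : Adm s P h) (N : ℕ) (hP : P N) :
    Adm s P (fun n => if n ≤ N then h n else 0) ∧ Adm s P (fun n => if n ≤ N then 0 else h n) := by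
  have hst : ∀ n, ¬ P n → (n + 1 ≤ N ↔ n ≤ N) := by
    intro n hn
    have : n ≠ N := by rintro rfl; exact hn hP
    omega
  refine ⟨⟨?_, ?_, ?_, ?_⟩, ⟨?_, ?_, ?_, ?_⟩⟩
  · simp [hh.zero]
  · simp [hh.one]
  · intro n hn; simp [hh.big n hn]
  · intro n hn hp; simp only [hst n hp, hh.step n hn hp]
  · simp
  · simp [hh.one]
  · intro n hn; simp [hh.big n hn]
  · intro n hn hp; simp only [hst n hp, hh.step n hn hp]

lemma cut_add (h : ℕ → ℤ) (N : ℕ) :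
    h = (fun n => if n ≤ N then h n else 0) + (fun n => if n ≤ N then 0 else h n) := by
  funext n; simp only [Pi.add_apply]; split_ifs <;> simp

/-- indicator of `(x, y]` -/
def ind (x y : ℕ) (n : ℕ) : ℤ := if x < n ∧ n ≤ y then 1 else 0

lemma beta_le {m : ℕ} {β : ℕ → ℕ} (hβ : ∀ i j, i < j → j ≤ m → β i < β j) {i j : ℕ}
    (hij : i ≤ j) (hj : j ≤ m) : β i ≤ β j := by
  rcases hij.eq_or_lt with rfl | h
  · exact le_rfl
  · exact (hβ i j h hj).le

lemma beta_lt_iff {m : ℕ} {β : ℕ → ℕ} (hβ : ∀ i j, i < j → j ≤ m → β i < β j) {i j : ℕ}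
    (hi : i ≤ m) (hj : j ≤ m) : β i < β j ↔ i < j := by
  constructor
  · intro h
    by_contra hc
    have := beta_le hβ (not_lt.mp hc) hi
    omega
  · intro h; exact hβ i j h hj

lemma not_mem_gap {m : ℕ} {β : ℕ → ℕ} (hβ : ∀ i j, i < j → j ≤ m → β i < β j) {P : ℕ → Prop}
    (hP : ∀ n, P n ↔ ∃ i ≤ m, β i = n) {k n : ℕ} (hk : k + 1 ≤ m) (h1 : β k < n)
    (h2 : n < β (k + 1)) : ¬ P n := by
  rw [hP]
  rintro ⟨i, hi, rfl⟩
  rw [beta_lt_iff hβ (by omega) (by omega)] at h1 h2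
  omega

lemma mu_eq (s t : ℕ) {m : ℕ} {β : ℕ → ℕ} (hβ : ∀ i j, i < j → j ≤ m → β i < β j)
    {P : ℕ → Prop} (hP : ∀ n, P n ↔ ∃ i ≤ m, β i = n) {k : ℕ} (hk1 : 1 ≤ k) (hk : k + 1 ≤ m) :
    cmMu s t β k = fvec s t (xs P (ind (β k) (β (k + 1)))) := by
  obtain ⟨k, rfl⟩ : ∃ j, k = j + 1 := ⟨k - 1, by omega⟩
  have hlt := hβ (k + 1) (k + 2) (by omega) hk
  have hPk : P (β (k + 1)) := (hP _).2 ⟨k + 1, by omega, rfl⟩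
  have hPk2 : P (β (k + 2)) := (hP _).2 ⟨k + 2, by omega, rfl⟩
  rw [show k + 1 + 1 = k + 2 from rfl]
  funext j
  rcases j with j | j
  · have hgap : β (k + 1) < j.val → j.val < β (k + 2) → ¬ P j.val :=
      fun h1 h2 => not_mem_gap hβ hP hk h1 h2
    simp only [cmMu, fvec, xs, ind, Sum.elim_inl]
    rcases lt_trichotomy j.val (β (k + 1)) with h | h | h
    · split_ifs <;> omega
    · rw [if_pos h, if_pos (h ▸ hPk), if_neg (by omega), if_pos (by omega)]; rfl
    · rcases lt_trichotomy j.val (β (k + 2)) with h' | h' | h'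
      · rw [if_neg (hgap h h')]; split_ifs <;> omega
      · split_ifs <;> omega
      · split_ifs <;> omega
  · simp [cmMu, fvec]

lemma mu_sum (s t : ℕ) {m : ℕ} {β : ℕ → ℕ} (hβ : ∀ i j, i < j → j ≤ m → β i < β j)
    {P : ℕ → Prop} (hP : ∀ n, P n ↔ ∃ i ≤ m, β i = n) {a : ℕ} (ha : 1 ≤ a) (b : ℕ) (hab : a ≤ b)
    (hb : b + 1 ≤ m) :
    ∑ i ∈ Finset.Icc a b, cmMu s t β i = fvec s t (xs P (ind (β a) (β (b + 1)))) := by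
  induction b, hab using Nat.le_induction with
  | base => simp [mu_eq s t hβ hP ha hb]
  | succ b hab ih =>
    rw [Finset.sum_Icc_succ_top (by omega), ih (by omega), mu_eq s t hβ hP (by omega) hb,
      ← fvec_add]
    congr 2
    have h1 := hβ a (b + 1) (by omega) (by omega)
    have h2 := hβ (b + 1) (b + 1 + 1) (by omega) (by omega)
    funext n
    simp only [Pi.add_apply, ind]
    split_ifs <;> omega

lemma norm_ge {s t m : ℕ} {β : ℕ → ℕ} (hβ : ∀ i j, i < j → j ≤ m → β i < β j) (hm : β m = s)
    {P : ℕ → Prop} (hP : ∀ n, P n ↔ ∃ i ≤ m, β i = n) {a b c : ℕ} (hac : a ≤ c) (hcb : c ≤ b)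
    (hb : b + 1 ≤ m) (hc : β c + 1 < β (c + 1)) :
    2 < cmInner (fvec s t (xs P (ind (β a) (β (b + 1)))))
      (fvec s t (xs P (ind (β a) (β (b + 1))))) := by
  rw [fvec_inner]
  have h1 : β a ≤ β c := beta_le hβ hac (by omega)
  have h2 : β (c + 1) ≤ β (b + 1) := beta_le hβ (by omega) (by omega)
  have h3 : β (b + 1) ≤ s := hm ▸ beta_le hβ hb le_rfl
  have hsub : ({β a, β c + 1, β (b + 1)} : Finset ℕ) ⊆ Finset.range (s + 1) := by
    intro x hx
    simp only [Finset.mem_insert, Finset.mem_singleton] at hx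
    simp only [Finset.mem_range]; omega
  refine lt_of_lt_of_le ?_ (Finset.sum_le_sum_of_subset_of_nonneg hsub
    (fun i _ _ => mul_self_nonneg _))
  have hPa : P (β a) := (hP _).2 ⟨a, by omega, rfl⟩
  have hPb : P (β (b + 1)) := (hP _).2 ⟨b + 1, by omega, rfl⟩
  have hPc : ¬ P (β c + 1) := not_mem_gap hβ hP (k := c) (by omega) (by omega) hc
  have e1 : xs P (ind (β a) (β (b + 1))) (β a) = -1 := by
    simp only [xs, if_pos hPa, ind]; split_ifs <;> omega
  have e2 : xs P (ind (β a) (β (b + 1))) (β c + 1) = 1 := by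
    simp only [xs, if_neg hPc, ind]; split_ifs <;> omega
  have e3 : xs P (ind (β a) (β (b + 1))) (β (b + 1)) = 1 := by
    simp only [xs, if_pos hPb, ind]; split_ifs <;> omega
  rw [Finset.sum_insert (by simp; omega), Finset.sum_insert (by simp; omega),
    Finset.sum_singleton, e1, e2, e3]
  norm_num

lemma mu_norm {s t m : ℕ} {β : ℕ → ℕ} (hβ : ∀ i j, i < j → j ≤ m → β i < β j) (hm : β m = s)
    {P : ℕ → Prop} (hP : ∀ n, P n ↔ ∃ i ≤ m, β i = n) {c : ℕ} (hc1 : 1 ≤ c) (hc : c + 1 ≤ m)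
    (hn : 2 < cmInner (cmMu s t β c) (cmMu s t β c)) : β c + 1 < β (c + 1) := by
  by_contra hcon
  have hlt := hβ c (c + 1) (by omega) hc
  have heq : β (c + 1) = β c + 1 := by omega
  have h3 : β (c + 1) ≤ s := hm ▸ beta_le hβ hc le_rfl
  rw [mu_eq s t hβ hP hc1 hc, fvec_inner] at hn
  have hPa : P (β c) := (hP _).2 ⟨c, by omega, rfl⟩
  have hPb : P (β c + 1) := (hP _).2 ⟨c + 1, by omega, heq⟩
  have hsub : ({β c, β c + 1} : Finset ℕ) ⊆ Finset.range (s + 1) := by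
    intro x hx
    simp only [Finset.mem_insert, Finset.mem_singleton] at hx
    simp only [Finset.mem_range]; omega
  rw [← Finset.sum_subset hsub, Finset.sum_pair (by omega), heq] at hn
  · have e1 : xs P (ind (β c) (β c + 1)) (β c) = -1 := by
      simp only [xs, if_pos hPa, ind]; split_ifs <;> omega
    have e2 : xs P (ind (β c) (β c + 1)) (β c + 1) = 1 := by
      simp only [xs, if_pos hPb, ind]; split_ifs <;> omega
    rw [e1, e2] at hn
    norm_num at hn
  · intro x _ hx
    simp only [Finset.mem_insert, Finset.mem_singleton, not_or] at hx
    have : xs P (ind (β c) (β (c + 1))) x = 0 := by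
      simp only [xs, ind]; split_ifs <;> omega
    rw [this]; rfl

lemma core {s t m : ℕ} {β : ℕ → ℕ} (hβ0 : β 0 = 0)
    (hβ : ∀ i j, i < j → j ≤ m → β i < β j) (hm : β m = s)
    {P : ℕ → Prop} (hP : ∀ n, P n ↔ ∃ i ≤ m, β i = n)
    (L : Set (Fin (s + 1) ⊕ Fin t → ℤ)) (hL : ∀ h, Adm s P h → fvec s t (xs P h) ∈ L)
    (v : Fin (s + 1) ⊕ Fin t → ℤ)
    (hirr : ∀ x y : Fin (s + 1) ⊕ Fin t → ℤ, x ∈ L → y ∈ L →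
      v = x + y → 0 ≤ cmInner x y → x = 0 ∨ y = 0)
    (hunb : ∀ x y : Fin (s + 1) ⊕ Fin t → ℤ, x ∈ L → y ∈ L →
      v = x + y → cmInner x y = -1 → cmInner x x = 2 ∨ cmInner y y = 2)
    (h : ℕ → ℤ) (hh : Adm s P h) (hv : v = fvec s t (xs P h)) (hpos : ∃ n, 1 ≤ h n) :
    ∃ (aa bb : ℕ), 1 ≤ aa ∧ aa ≤ bb ∧ bb ≤ m - 1 ∧
      v = (∑ i ∈ Finset.Icc aa bb, cmMu s t β i) ∧
      (∀ c₁ c₂, aa ≤ c₁ → c₁ ≤ bb → aa ≤ c₂ → c₂ ≤ bb →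
        2 < cmInner (cmMu s t β c₁) (cmMu s t β c₁) →
        2 < cmInner (cmMu s t β c₂) (cmMu s t β c₂) → c₁ = c₂) := by
  -- thresholding
  have h01 : ∀ n, h n = 0 ∨ h n = 1 := by
    set φ : ℕ → ℤ := fun n => if 1 ≤ h n then 1 else 0 with hφ
    set ψ : ℕ → ℤ := fun n => if 1 ≤ h n then h n - 1 else h n with hψ
    have hsum : h = φ + ψ := by
      funext n; simp only [hφ, hψ, Pi.add_apply]; split_ifs <;> ring
    have aφ : Adm s P φ := by
      refine ⟨?_, ?_, ?_, ?_⟩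
      · simp [hφ, hh.zero]
      · simp [hφ, hh.one]
      · intro n hn; simp [hφ, hh.big n hn]
      · intro n hn hp; simp [hφ, hh.step n hn hp]
    have aψ : Adm s P ψ := by
      refine ⟨?_, ?_, ?_, ?_⟩
      · simp [hψ, hh.zero]
      · simp [hψ, hh.one]
      · intro n hn; simp [hψ, hh.big n hn]
      · intro n hn hp; simp [hψ, hh.step n hn hp]
    have hin : 0 ≤ cmInner (fvec s t (xs P φ)) (fvec s t (xs P ψ)) := by
      rw [fvec_inner]
      refine Finset.sum_nonneg fun n _ => ?_
      simp only [xs, hφ, hψ]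
      split_ifs <;> simp <;> omega
    rcases hirr _ _ (hL _ aφ) (hL _ aψ) (by rw [hv, ← fvec_add, ← hsum]) hin with h0 | h0
    · obtain ⟨n, hn⟩ := hpos
      have := adm_zero aφ h0 n
      simp [hφ] at this; omega
    · intro n
      have := adm_zero aψ h0 n
      simp only [hψ] at this
      split_ifs at this <;> omega
  -- first index
  have hex : ∃ n, h n = 1 := by
    obtain ⟨n, hn⟩ := hpos
    exact ⟨n, by have := h01 n; omega⟩
  classical
  obtain ⟨A, hA, hAmin⟩ : ∃ A, h A = 1 ∧ ∀ n < A, h n = 0 :=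
    ⟨Nat.find hex, Nat.find_spec hex, fun n hn => by
      have := Nat.find_min hex hn; have := h01 n; tauto⟩
  have hA0 : A ≠ 0 := by rintro rfl; have := hh.zero; omega
  have hA1 : A ≠ 1 := by rintro rfl; have := hh.one; omega
  have hAs : A ≤ s := by by_contra hc; have := hh.big A (by omega); omega
  have hex2 : ∃ n, A ≤ n ∧ h (n + 1) = 0 := ⟨s, hAs, hh.big _ (by omega)⟩
  obtain ⟨B, hAB, hB, hBmin⟩ : ∃ B, A ≤ B ∧ h (B + 1) = 0 ∧ ∀ n, A ≤ n → n < B → h (n + 1) = 1 :=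
    ⟨Nat.find hex2, (Nat.find_spec hex2).1, (Nat.find_spec hex2).2, fun n h1 h2 => by
      have := Nat.find_min hex2 h2; have := h01 (n + 1); tauto⟩
  have hmid : ∀ n, A ≤ n → n ≤ B → h n = 1 := by
    intro n h1 h2
    rcases h1.eq_or_lt with rfl | h1
    · exact hA
    · have := hBmin (n - 1) (by omega) (by omega)
      rwa [Nat.sub_add_cancel (by omega)] at this
  have hBs : B ≤ s := by
    by_contra hc; have := hh.big B (by omega); have := hmid B hAB le_rfl; omega
  have hPB : P B := by
    by_contra hc
    have := hh.step B hBs hc; have := hmid B hAB le_rfl; omega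
  have hPA : P (A - 1) := by
    by_contra hc
    have := hh.step (A - 1) (by omega) hc
    rw [Nat.sub_add_cancel (by omega)] at this
    have := hAmin (A - 1) (by omega); omega
  have hind : h = ind (A - 1) B := by
    obtain ⟨a1, a2⟩ := cut_adm hh B hPB
    rcases hirr _ _ (hL _ a1) (hL _ a2) (by rw [hv, ← fvec_add, ← cut_add])
      (by rw [cut_inner h B hBs hPB, hB]; simp) with h0 | h0
    · have := adm_zero a1 h0 A
      simp [hAB, hA] at this
    · funext n
      have := adm_zero a2 h0 n
      simp only [ind]
      by_cases h1 : n < A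
      · rw [hAmin n h1, if_neg (by omega)]
      · by_cases h2 : n ≤ B
        · rw [hmid n (by omega) h2, if_pos (by omega)]
        · rw [if_neg h2] at this
          rw [this, if_neg (by omega)]
  obtain ⟨a, ham, ha⟩ := (hP _).1 hPA
  obtain ⟨b', hbm, hb⟩ := (hP _).1 hPB
  have hab : a < b' := by
    rw [← beta_lt_iff hβ ham hbm]; omega
  obtain ⟨b, rfl⟩ : ∃ b, b' = b + 1 := ⟨b' - 1, by omega⟩
  have ha1 : 1 ≤ a := by
    by_contra hc
    have : a = 0 := by omega
    subst this; omega
  rw [← ha, ← hb] at hind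
  have main : ∀ c₁ c₂, a ≤ c₁ → c₂ ≤ b → c₁ < c₂ →
        2 < cmInner (cmMu s t β c₁) (cmMu s t β c₁) →
        2 < cmInner (cmMu s t β c₂) (cmMu s t β c₂) → False := by
    intro c₁ c₂ h1 h2 h12 n1 n2
    have g1 := mu_norm hβ hm hP (by omega) (by omega) n1
    have g2 := mu_norm hβ hm hP (by omega) (by omega) n2
    have hPN : P (β (c₁ + 1)) := (hP _).2 ⟨c₁ + 1, by omega, rfl⟩
    have q1 := hβ a (c₁ + 1) (by omega) (by omega)
    have q2 := hβ (c₁ + 1) (b + 1) (by omega) (by omega)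
    have hNs : β (c₁ + 1) ≤ s := by omega
    obtain ⟨a1, a2⟩ := cut_adm hh _ hPN
    have hc := hunb _ _ (hL _ a1) (hL _ a2) (by rw [hv, ← fvec_add, ← cut_add]) (by
      rw [cut_inner h _ hNs hPN, hind]
      simp only [ind]; rw [if_pos (by omega), if_pos (by omega)]; rfl)
    have r1 : (fun n => if n ≤ β (c₁ + 1) then h n else 0) = ind (β a) (β (c₁ + 1)) := by
      funext n; rw [hind]; simp only [ind]; split_ifs <;> omega
    have r2 : (fun n => if n ≤ β (c₁ + 1) then 0 else h n) = ind (β (c₁ + 1)) (β (b + 1)) := by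
      funext n; rw [hind]; simp only [ind]; split_ifs <;> omega
    rw [r1, r2] at hc
    have k1 := norm_ge (t := t) hβ hm hP (a := a) (b := c₁) (c := c₁) h1 le_rfl (by omega) g1
    have k2 := norm_ge (t := t) hβ hm hP (a := c₁ + 1) (b := b) (c := c₂) h12 h2 (by omega) g2
    omega
  refine ⟨a, b, ha1, by omega, by omega, ?_, ?_⟩
  · rw [mu_sum s t hβ hP ha1 b (by omega) hbm, hv, hind]
  · intro c₁ c₂ h1 h2 h3 h4 n1 n2
    rcases lt_trichotomy c₁ c₂ with hlt | heq | hgt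
    · exact (main c₁ c₂ h1 h4 hlt n1 n2).elim
    · exact heq
    · exact (main c₂ c₁ h3 h2 hgt n2 n1).elim

lemma inner_w0 (s t : ℕ) (σ : ℕ → ℤ) (α : ℕ → ℕ) (x : Fin (s + 1) ⊕ Fin t → ℤ) :
    cmInner x (cmW s t σ α 0) = x (Sum.inl 0) + ∑ i : Fin t, x (Sum.inr i) * σ i.val := by
  simp only [cmInner, cmW, Fintype.sum_sum_type]
  congr 1
  rw [Finset.sum_eq_single 0]
  · simp
  · intro b _ hb
    have hb' : ¬ b.val = 0 := fun h => hb (Fin.ext h)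
    rw [if_neg hb', mul_zero]
  · simp

lemma inner_wk (s t : ℕ) (σ : ℕ → ℤ) (α : ℕ → ℕ) (k : ℕ) (h1 : α k < α (k + 1))
    (h2 : α (k + 1) ≤ s) (x : Fin (s + 1) ⊕ Fin t → ℤ) (u : ℕ → ℤ)
    (hu : ∀ i : Fin (s + 1), x (Sum.inl i) = u i.val) :
    cmInner x (cmW s t σ α (k + 1)) = - u (α k) + ∑ n ∈ Finset.Ioc (α k) (α (k + 1)), u n := by
  simp only [cmInner, cmW, Fintype.sum_sum_type, hu, mul_zero, Finset.sum_const_zero, add_zero]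
  rw [← Finset.sum_range (fun n => u n * (if n = α k then -1 else
    if α k < n ∧ n ≤ α (k + 1) then 1 else 0))]
  have : ∀ n ∈ Finset.range (s + 1), u n * (if n = α k then -1 else
      if α k < n ∧ n ≤ α (k + 1) then 1 else 0) =
      (if n = α k then - u n else 0) + (if n ∈ Finset.Ioc (α k) (α (k + 1)) then u n else 0) := by
    intro n _
    simp only [Finset.mem_Ioc]
    split_ifs <;> omega
  rw [Finset.sum_congr rfl this, Finset.sum_add_distrib, Finset.sum_ite_eq', if_pos (by simp; omega),
    Finset.sum_ite_mem, Finset.inter_eq_right.2]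
  intro n hn
  simp only [Finset.mem_Ioc] at hn
  simp only [Finset.mem_range]; omega

lemma telesc (h : ℕ → ℤ) (x y : ℕ) (hxy : x < y) (u : ℕ → ℤ)
    (hu : ∀ n, x < n → n < y → u n = h n - h (n + 1)) :
    ∑ n ∈ Finset.Ioc x y, u n = h (x + 1) - h y + u y := by
  obtain ⟨d, rfl⟩ : ∃ d, y = x + 1 + d := ⟨y - (x + 1), by omega⟩
  induction d generalizing u with
  | zero => simp
  | succ d ih =>
    rw [← add_assoc, Finset.sum_Ioc_succ_top (by omega),
      ih u (by omega) (fun n h1 h2 => hu n h1 (by omega)), hu (x + 1 + d) (by omega) (by omega)]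
    ring

/-- Structure of irreducible unbreakable vectors of a `p/q`-changemaker lattice
(`q > 1`) pairing non-trivially with some `f_i` but trivially with `f_0`:  up to
sign, such a vector is `μ_a + … + μ_b` with `1 ≤ a ≤ b ≤ m − 1`, where at most one
`μ_c` with `a ≤ c ≤ b` has norm greater than two. -/
theorem stmt_15
    (p q : ℕ) (hp : 0 < p) (hq : 1 < q) (hpq : Nat.Coprime p q)
    (l : ℕ) (hl : 1 ≤ l)
    (a : ℕ → ℕ) (ha0 : 1 ≤ a 0) (ha : ∀ i, 1 ≤ i → i ≤ l → 2 ≤ a i)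
    (hcf : negCF (fun i => (a i : ℤ)) (l + 1) = (p : ℚ) / q)
    (s : ℕ) (hs : s = ∑ i ∈ Finset.Icc 1 l, (a i - 1))
    (α : ℕ → ℕ) (hα : ∀ k, α k = ∑ i ∈ Finset.Icc 1 k, (a i - 1))
    (t : ℕ) (ht : 1 ≤ t)
    (σ : ℕ → ℤ) (hσpos : ∀ i < t, 0 < σ i)
    (hσmono : ∀ i j, i ≤ j → j < t → σ i ≤ σ j)
    (hσcm : Changemaker t σ)
    (hσnorm : 1 + ∑ i ∈ Finset.range t, σ i ^ 2 = (a 0 : ℤ))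
    (m : ℕ) (β : ℕ → ℕ)
    (hβ0 : β 0 = 0) (hβm : β m = s)
    (hβmono : ∀ i j, i < j → j ≤ m → β i < β j)
    (hβmem : ∀ n, (n ≤ s ∧ ∀ k, 1 ≤ k → k ≤ l - 1 → n ≠ α k) ↔ ∃ i ≤ m, β i = n)
    (v : Fin (s + 1) ⊕ Fin t → ℤ)
    (hvL : v ∈ cmLattice s t l σ α)
    (hirr : ∀ x y : Fin (s + 1) ⊕ Fin t → ℤ,
      x ∈ cmLattice s t l σ α → y ∈ cmLattice s t l σ α →
      v = x + y → 0 ≤ cmInner x y → x = 0 ∨ y = 0)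
    (hunb : ∀ x y : Fin (s + 1) ⊕ Fin t → ℤ,
      x ∈ cmLattice s t l σ α → y ∈ cmLattice s t l σ α →
      v = x + y → cmInner x y = -1 → cmInner x x = 2 ∨ cmInner y y = 2)
    (hf : ∃ i : Fin (s + 1), v (Sum.inl i) ≠ 0)
    (hf0 : v (Sum.inl 0) = 0) :
    ∃ (ε : ℤ) (aa bb : ℕ), (ε = 1 ∨ ε = -1) ∧ 1 ≤ aa ∧ aa ≤ bb ∧ bb ≤ m - 1 ∧
      ε • v = (∑ i ∈ Finset.Icc aa bb, cmMu s t β i) ∧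
      (∀ c₁ c₂, aa ≤ c₁ → c₁ ≤ bb → aa ≤ c₂ → c₂ ≤ bb →
        2 < cmInner (cmMu s t β c₁) (cmMu s t β c₁) →
        2 < cmInner (cmMu s t β c₂) (cmMu s t β c₂) → c₁ = c₂) := by
  classical
  set P : ℕ → Prop := fun n => ∃ i ≤ m, β i = n with hPdef
  have hP : ∀ n, P n ↔ ∃ i ≤ m, β i = n := fun n => Iff.rfl
  have hα0 : α 0 = 0 := by simp [hα]
  have hαs : ∀ k, α (k + 1) = α k + (a (k + 1) - 1) := by
    intro k; rw [hα, hα, Finset.sum_Icc_succ_top (by omega)]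
  have hαl : α l = s := by rw [hα, hs]
  have hαm : Monotone α := monotone_nat_of_le_succ (fun k => by rw [hαs]; omega)
  have hαlt : ∀ k, k + 1 ≤ l → α k < α (k + 1) := by
    intro k hk; rw [hαs]; have := ha (k + 1) (by omega) hk; omega
  have hαle : ∀ k, k ≤ l → α k ≤ s := fun k hk => hαl ▸ hαm hk
  have hnP : ∀ k, 1 ≤ k → k < l → ¬ P (α k) := by
    intro k h1 h2 h3
    exact ((hβmem _).2 h3).2 k h1 (by omega) rfl
  have hPin : ∀ k n, k + 1 ≤ l → α k < n → n < α (k + 1) → P n := by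
    intro k n hk h1 h2
    refine (hβmem n).1 ⟨by have := hαle _ hk; omega, ?_⟩
    rintro j _ _ rfl
    rcases Nat.lt_or_ge k j with h | h
    · have := hαm (show k + 1 ≤ j from h); omega
    · have := hαm h; omega
  have hPs : P s := ⟨m, le_rfl, hβm⟩
  have hP' : ∀ n, n ≤ s → ¬ P n → ∃ k, 1 ≤ k ∧ k < l ∧ n = α k := by
    intro n hn hp
    by_contra hc
    push Not at hc
    exact hp ((hβmem n).1 ⟨hn, fun k h1 h2 => hc k h1 (by omega)⟩)
  have hL : ∀ h, Adm s P h → fvec s t (xs P h) ∈ cmLattice s t l σ α := by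
    intro h hh k hk
    have h00 : xs P h 0 = 0 := by
      simp only [xs, hh.zero, hh.one, zero_add]; split_ifs <;> rfl
    rcases k with _ | k
    · rw [inner_w0]; simpa [fvec] using h00
    · rw [inner_wk s t σ α k (hαlt k hk) (hαle _ hk) _ (xs P h) (fun _ => rfl),
        telesc h _ _ (hαlt k hk)]
      · have e1 : xs P h (α (k + 1)) = h (α (k + 1)) := by
          rcases hk.eq_or_lt with h1 | h1
          · rw [h1, hαl]; simp [xs, hPs, hh.big (s + 1) (by omega)]
          · simp [xs, hnP (k + 1) (by omega) h1]
        have e2 : xs P h (α k) = h (α k + 1) := by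
          rcases k with _ | k
          · rw [hα0, h00, zero_add, hh.one]
          · have := hnP (k + 1) (by omega) (by omega)
            rw [hh.step _ (hαle _ (by omega)) this]; simp [xs, this]
        rw [e1, e2]; ring
      · intro n h1 h2
        simp [xs, hPin k n hk h1 h2]
  -- the e-part of v vanishes
  have hvin : ∀ i : Fin t, v (Sum.inr i) = 0 := by
    set x : Fin (s + 1) ⊕ Fin t → ℤ := Sum.elim (fun i => v (Sum.inl i)) (fun _ => 0) with hx
    set y : Fin (s + 1) ⊕ Fin t → ℤ := Sum.elim (fun _ => 0) (fun i => v (Sum.inr i)) with hy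
    have hxL : x ∈ cmLattice s t l σ α := by
      intro k hk
      rcases k with _ | k
      · rw [inner_w0]; simp [hx, hf0]
      · rw [← hvL (k + 1) hk]
        simp [cmInner, cmW, hx]
    have hyL : y ∈ cmLattice s t l σ α := by
      intro k hk
      rcases k with _ | k
      · have := hvL 0 (by omega)
        rw [inner_w0, hf0] at this
        rw [inner_w0]; simpa [hy] using this
      · simp [cmInner, cmW, hy]
    rcases hirr x y hxL hyL (by funext j; rcases j with j | j <;> simp [hx, hy])
      (by simp [cmInner, hx, hy]) with h0 | h0
    · obtain ⟨i, hi⟩ := hf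
      exact (hi (congrFun h0 (Sum.inl i))).elim
    · intro i; exact congrFun h0 (Sum.inr i)
  set u : ℕ → ℤ := fun n => if hn : n < s + 1 then v (Sum.inl ⟨n, hn⟩) else 0 with hu
  have huv : ∀ i : Fin (s + 1), v (Sum.inl i) = u i.val := by
    intro i; simp only [hu]; rw [dif_pos i.isLt]
  have hu0 : u 0 = 0 := by rw [← hf0, huv]; rfl
  have hubig : ∀ n, s < n → u n = 0 := by
    intro n hn; simp only [hu]; rw [dif_neg (by omega)]
  have huk : ∀ k, k + 1 ≤ l → ∑ n ∈ Finset.Ioc (α k) (α (k + 1)), u n = u (α k) := by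
    intro k hk
    have := hvL (k + 1) hk
    rw [inner_wk s t σ α k (hαlt k hk) (hαle _ hk) _ u huv] at this
    omega
  set h : ℕ → ℤ := fun n => - ∑ i ∈ Finset.range n, if P i then u i else 0 with hh
  have hsucc : ∀ n, h (n + 1) = h n - if P n then u n else 0 := by
    intro n; simp only [hh, Finset.sum_range_succ]; ring
  have h0 : h 0 = 0 := by simp [hh]
  have h1 : h 1 = 0 := by rw [show 1 = 0 + 1 from rfl, hsucc, h0, hu0]; simp
  have hC : ∀ k, k ≤ l → u (α k) = h (α k) := by
    intro k
    induction k with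
    | zero => intro _; rw [hα0, hu0, h0]
    | succ k ih =>
      intro hk
      have e := huk k hk
      rw [telesc h _ _ (hαlt k hk)] at e
      · have e2 : h (α k + 1) = u (α k) := by
          rcases k with _ | k
          · rw [hα0, hu0, zero_add, h1]
          · rw [hsucc, if_neg (hnP (k + 1) (by omega) (by omega)), ih (by omega), sub_zero]
        omega
      · intro n g1 g2
        rw [hsucc, if_pos (hPin k n hk g1 g2)]; ring
  have hux : ∀ n, n ≤ s → u n = xs P h n := by
    intro n hn
    by_cases hp : P n
    · simp [xs, hp, hsucc]
    · obtain ⟨k, _, hk2, rfl⟩ := hP' n hn hp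
      simp [xs, hp, hC k hk2.le]
  have hbig : ∀ n, s + 1 ≤ n → h n = 0 := by
    intro n hn
    induction n, hn using Nat.le_induction with
    | base =>
      have := hC l le_rfl
      rw [hαl] at this
      rw [hsucc, if_pos hPs, this, sub_self]
    | succ n hn ih =>
      rw [hsucc, ih, hubig n (by omega)]; simp
  have hadm : Adm s P h := ⟨h0, h1, fun n hn => hbig n hn, fun n _ hp => by
    rw [hsucc, if_neg hp, sub_zero]⟩
  have hv : v = fvec s t (xs P h) := by
    funext j
    rcases j with j | j
    · rw [huv, hux _ (by omega)]; rfl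
    · rw [hvin]; rfl
  have hne : ∃ n, h n ≠ 0 := by
    by_contra hc
    push Not at hc
    obtain ⟨i, hi⟩ := hf
    apply hi
    rw [hv]
    simp [fvec, xs, hc]
  obtain ⟨n, hn⟩ := hne
  rcases lt_or_gt_of_ne hn with hneg | hpos
  · have hadm' : Adm s P (-h) := by
      refine ⟨by simp [h0], by simp [h1], fun n hn => by simp [hbig n hn], fun n hn hp => ?_⟩
      simp [hadm.step n hn hp]
    have hLneg : ∀ x, x ∈ cmLattice s t l σ α → -x ∈ cmLattice s t l σ α := by
      intro x hx k hk
      have := hx k hk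
      simp only [cmInner, Pi.neg_apply, neg_mul, Finset.sum_neg_distrib] at this ⊢
      omega
    have hin : ∀ x y : Fin (s + 1) ⊕ Fin t → ℤ, cmInner (-x) (-y) = cmInner x y := by
      intro x y; simp [cmInner]
    obtain ⟨aa, bb, p1, p2, p3, p4, p5⟩ := core hβ0 hβmono hβm hP _ hL (-v)
      (fun x y hx hy hxy hi => by
        have := hirr (-x) (-y) (hLneg x hx) (hLneg y hy)
          (by rw [← neg_neg v, hxy]; abel) (by rwa [hin])
        simpa using this)
      (fun x y hx hy hxy hi => by
        have := hunb (-x) (-y) (hLneg x hx) (hLneg y hy)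
          (by rw [← neg_neg v, hxy]; abel) (by rwa [hin])
        simpa only [hin] using this)
      (-h) hadm' (by
        rw [hv]; funext j
        rcases j with j | j
        · simp only [fvec, xs, Pi.neg_apply, Sum.elim_inl]; split_ifs <;> ring
        · simp [fvec]) ⟨n, by simp only [Pi.neg_apply]; omega⟩
    exact ⟨-1, aa, bb, Or.inr rfl, p1, p2, p3, by rw [← p4]; simp, p5⟩
  · obtain ⟨aa, bb, p1, p2, p3, p4, p5⟩ := core hβ0 hβmono hβm hP _ hL v hirr hunb h hadm hv
      ⟨n, by omega⟩
    exact ⟨1, aa, bb, Or.inl rfl, p1, p2, p3, by rw [← p4]; simp, p5⟩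
end

section
/- Let L ⊆ ℤ^{s+t+1} be a p/q-changemaker lattice with q > 1. Suppose v ∈ L is irreducible and unbreakable and v·f_0 ≠ 0. Then there exist a sign ε ∈ {1, −1}, indices 1 ≤ k ≤ g ≤ t with σ_k tight and σ_g = σ_k, and an index 0 ≤ b ≤ m−1, such that ε·v = −e_g + e_{k−1} + e_{k−2} + … + e_1 + μ_0 + μ_1 + … + μ_b, and μ_i·μ_i = 2 for all 1 ≤ i ≤ b. -/
open Classical in
/-- extension of the `f`-part to all naturals -/
noncomputable def hX {s t : ℕ} (x : Fin (s + 1) ⊕ Fin t → ℤ) (i : ℕ) : ℤ :=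
  if h : i < s + 1 then x (Sum.inl ⟨i, h⟩) else 0

/-- the set `M` -/
def hM (s l : ℕ) (α : ℕ → ℕ) (n : ℕ) : Prop := n ≤ s ∧ ∀ k, 1 ≤ k → k ≤ l - 1 → n ≠ α k

open Classical in
/-- indicator of the support of `μ_0 + … + μ_b` where `n = β_{b+1}` -/
noncomputable def hphi (s l : ℕ) (α : ℕ → ℕ) (n i : ℕ) : ℤ :=
  if i = 0 ∨ i = n ∨ (i < n ∧ ¬ hM s l α i) then 1 else 0

theorem hX_val {s t : ℕ} (x : Fin (s + 1) ⊕ Fin t → ℤ) (i : Fin (s + 1)) :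
    hX x i.val = x (Sum.inl i) := by
  unfold hX
  rw [dif_pos i.2]

theorem inner_split {s t : ℕ} (x y : Fin (s + 1) ⊕ Fin t → ℤ) :
    cmInner x y = (∑ i, x (Sum.inl i) * y (Sum.inl i)) + ∑ i, x (Sum.inr i) * y (Sum.inr i) := by
  simp [cmInner, Fintype.sum_sum_type]

theorem inner_W0 {s t : ℕ} (σ : ℕ → ℤ) (α : ℕ → ℕ) (x : Fin (s + 1) ⊕ Fin t → ℤ) :
    cmInner x (cmW s t σ α 0) = x (Sum.inl 0) + ∑ i : Fin t, x (Sum.inr i) * σ i := by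
  rw [inner_split]
  congr 1
  rw [Finset.sum_eq_single 0]
  · simp [cmW]
  · intro b _ hb
    have : b.val ≠ 0 := fun h => hb (Fin.ext h)
    simp [cmW, hb]
  · simp

theorem inner_Wk {s t : ℕ} (σ : ℕ → ℤ) (α : ℕ → ℕ) (k : ℕ) (h1 : α k < α (k+1))
    (h2 : α (k+1) ≤ s) (x : Fin (s + 1) ⊕ Fin t → ℤ) :
    cmInner x (cmW s t σ α (k+1)) = (∑ i ∈ Finset.Ioc (α k) (α (k+1)), hX x i) - hX x (α k) := by
  rw [inner_split]
  have e1 : ∑ i, x (Sum.inl i) * cmW s t σ α (k+1) (Sum.inl i)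
      = ∑ i : Fin (s+1), (fun j : ℕ => hX x j *
        (if j = α k then -1 else if α k < j ∧ j ≤ α (k + 1) then 1 else 0)) i.val := by
    apply Finset.sum_congr rfl
    intro i _
    simp only [hX_val, cmW]
  rw [e1, Fin.sum_univ_eq_sum_range (fun j : ℕ => hX x j *
        (if j = α k then -1 else if α k < j ∧ j ≤ α (k + 1) then 1 else 0))]
  have e2 : ∑ i : Fin t, x (Sum.inr i) * cmW s t σ α (k+1) (Sum.inr i) = 0 := by
    simp [cmW]
  rw [e2, add_zero]
  have e3 : ∀ j : ℕ, hX x j * (if j = α k then -1 else if α k < j ∧ j ≤ α (k + 1) then 1 else 0)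
      = (if j ∈ Finset.Ioc (α k) (α (k+1)) then hX x j else 0) - (if j = α k then hX x j else 0) := by
    intro j
    simp only [Finset.mem_Ioc]
    by_cases h : j = α k
    · simp [h]
    · by_cases h' : α k < j ∧ j ≤ α (k+1)
      · simp [h, h']
      · simp only [h, h', if_false]; simp
  simp only [e3]
  rw [Finset.sum_sub_distrib, Finset.sum_ite_mem, Finset.sum_ite_eq']
  have : Finset.range (s+1) ∩ Finset.Ioc (α k) (α (k+1)) = Finset.Ioc (α k) (α (k+1)) := by
    ext j; simp only [Finset.mem_inter, Finset.mem_range, Finset.mem_Ioc]; omega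
  rw [this, if_pos (by simp; omega)]

theorem mem_L {s t l : ℕ} (σ : ℕ → ℤ) (α : ℕ → ℕ) (hlt : ∀ k < l, α k < α (k+1))
    (hle : ∀ k ≤ l, α k ≤ s) (x : Fin (s + 1) ⊕ Fin t → ℤ) :
    x ∈ cmLattice s t l σ α ↔ (x (Sum.inl 0) + ∑ i : Fin t, x (Sum.inr i) * σ i = 0) ∧
      ∀ k < l, ∑ i ∈ Finset.Ioc (α k) (α (k+1)), hX x i = hX x (α k) := by
  constructor
  · intro h
    refine ⟨?_, ?_⟩
    · rw [← inner_W0 σ α]; exact h 0 (Nat.zero_le _)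
    · intro k hk
      have := h (k+1) hk
      rw [inner_Wk σ α k (hlt k hk) (hle _ hk)] at this
      linarith
  · rintro ⟨h0, h1⟩ k hk
    cases k with
    | zero => rw [inner_W0]; exact h0
    | succ k =>
      rw [inner_Wk σ α k (hlt k hk) (hle _ hk), h1 k hk, sub_self]

theorem L_sub {s t l : ℕ} {σ : ℕ → ℤ} {α : ℕ → ℕ} {x y : Fin (s + 1) ⊕ Fin t → ℤ}
    (hx : x ∈ cmLattice s t l σ α) (hy : y ∈ cmLattice s t l σ α) :
    x - y ∈ cmLattice s t l σ α := by
  intro k hk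
  have h1 := hx k hk
  have h2 := hy k hk
  simp only [cmInner, Pi.sub_apply, sub_mul, Finset.sum_sub_distrib] at *
  rw [h1, h2, sub_zero]

theorem L_neg {s t l : ℕ} {σ : ℕ → ℤ} {α : ℕ → ℕ} {x : Fin (s + 1) ⊕ Fin t → ℤ}
    (hx : x ∈ cmLattice s t l σ α) :
    -x ∈ cmLattice s t l σ α := by
  intro k hk
  have h1 := hx k hk
  simp only [cmInner, Pi.neg_apply, neg_mul, Finset.sum_neg_distrib] at *
  rw [h1, neg_zero]

theorem mono_of {l : ℕ} {α : ℕ → ℕ} (hlt : ∀ k < l, α k < α (k+1)) :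
    ∀ i j, i < j → j ≤ l → α i < α j := by
  intro i j hij
  induction j with
  | zero => omega
  | succ j ih =>
    intro hj
    have := hlt j hj
    rcases Nat.lt_succ_iff_lt_or_eq.mp hij with h | h
    · have := ih h (by omega); omega
    · subst h; exact this

theorem mono_inv {l : ℕ} {α : ℕ → ℕ} (hlt : ∀ k < l, α k < α (k+1)) :
    ∀ i j, i ≤ l → α i < α j → i < j := by
  intro i j hi h
  by_contra hc
  rcases Nat.lt_or_eq_of_le (not_lt.mp hc) with h' | h'
  · have := mono_of hlt j i h' hi; omega
  · subst h'; omega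

theorem phi_block {s l : ℕ} {α : ℕ → ℕ} (h0 : α 0 = 0) (hl : α l = s)
    (hlt : ∀ k < l, α k < α (k+1)) (n : ℕ) (hn : 1 ≤ n) (hnM : hM s l α n) (k : ℕ) (hk : k < l) :
    ∑ i ∈ Finset.Ioc (α k) (α (k+1)), hphi s l α n i = hphi s l α n (α k) := by
  have hnin : α k ≠ n := by
    rcases Nat.eq_zero_or_pos k with h | h
    · subst h; omega
    · exact fun h' => hnM.2 k h (by omega) h'.symm
  have hnot : ∀ i, i ≤ s → ¬ hM s l α i → ∃ r, 1 ≤ r ∧ r < l ∧ i = α r := by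
    intro i hi h
    unfold hM at h
    push Not at h
    obtain ⟨r, h1, h2, h3⟩ := h hi
    exact ⟨r, h1, by omega, h3⟩
  have hns : n ≤ s := hnM.1
  by_cases hc : n < α k
  · rw [Finset.sum_eq_zero]
    · rw [hphi, if_neg]; omega
    · intro i hi
      rw [Finset.mem_Ioc] at hi
      rw [hphi, if_neg]; omega
  · have hphik : hphi s l α n (α k) = 1 := by
      rw [hphi, if_pos]
      rcases Nat.eq_zero_or_pos k with h | h
      · subst h; left; exact h0
      · right; right
        exact ⟨by omega, fun h' => h'.2 k h (by omega) rfl⟩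
    rw [hphik]
    have key : ∀ c, c ∈ Finset.Ioc (α k) (α (k+1)) → hphi s l α n c = 1 →
        (∀ i ∈ Finset.Ioc (α k) (α (k+1)), (i = n ∨ (i < n ∧ ¬ hM s l α i)) → i = c) →
        ∑ i ∈ Finset.Ioc (α k) (α (k+1)), hphi s l α n i = 1 := by
      intro c hc1 hc2 hc3
      rw [Finset.sum_eq_single c]
      · exact hc2
      · intro i hi hic
        rw [hphi, if_neg]
        rintro (h | h)
        · rw [Finset.mem_Ioc] at hi; omega
        · exact hic (hc3 i hi h)
      · intro h; exact absurd hc1 h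
    by_cases hc2 : n ≤ α (k+1)
    · apply key n
      · rw [Finset.mem_Ioc]; omega
      · simp [hphi]
      · rintro i hi (h | ⟨h, h'⟩)
        · exact h
        · rw [Finset.mem_Ioc] at hi
          obtain ⟨r, h1, h2, h3⟩ := hnot i (by omega) h'
          have a1 := mono_inv hlt k r (by omega) (by omega)
          have a2 := mono_inv hlt r (k+1) (by omega) (by omega)
          omega
    · have hkl : k + 1 < l := by
        by_contra h
        have : k + 1 = l := by omega
        rw [this] at hc2; omega
      have := hlt k hk
      apply key (α (k+1))
      · rw [Finset.mem_Ioc]; omega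
      · rw [hphi, if_pos]
        right; right
        exact ⟨by omega, fun h' => h'.2 (k+1) (by omega) (by omega) rfl⟩
      · rintro i hi (h | ⟨h, h'⟩)
        · rw [Finset.mem_Ioc] at hi; omega
        · rw [Finset.mem_Ioc] at hi
          obtain ⟨r, h1, h2, h3⟩ := hnot i (by omega) h'
          have a1 := mono_inv hlt k r (by omega) (by omega)
          by_contra hne
          have a2 := mono_inv hlt r (k+1) (by omega) (by omega)
          omega

open Classical in
/-- tail sums -/
noncomputable def hC (s l : ℕ) (α : ℕ → ℕ) (V : ℕ → ℤ) (n : ℕ) : ℤ :=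
  ∑ i ∈ Finset.Ioc n s, if hM s l α i then V i else 0

theorem hC_split (s l : ℕ) (α : ℕ → ℕ) (V : ℕ → ℤ) (n k : ℕ) (h : n ≤ k) (h' : k ≤ s) :
    hC s l α V n = (open Classical in ∑ i ∈ Finset.Ioc n k, if hM s l α i then V i else 0)
      + hC s l α V k := by
  unfold hC
  rw [Finset.sum_Ioc_consecutive _ h h']

theorem hC_alpha {s l : ℕ} {α : ℕ → ℕ} (hl : α l = s)
    (hlt : ∀ k < l, α k < α (k+1)) (hle : ∀ k ≤ l, α k ≤ s) (V : ℕ → ℤ)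
    (hV : ∀ k < l, ∑ i ∈ Finset.Ioc (α k) (α (k+1)), V i = V (α k)) :
    ∀ d k, k < l → k + d + 1 = l → hC s l α V (α k) = V (α k) := by
  have blk : ∀ k, k < l → ∀ i, α k < i → i < α (k+1) → hM s l α i := by
    intro k hk i h1 h2
    refine ⟨by have := hle (k+1) hk; omega, ?_⟩
    intro r hr hr' h
    have a1 := mono_inv hlt k r (by omega) (by omega)
    have a2 := mono_inv hlt r (k+1) (by omega) (by omega)
    omega
  have blkS : ∀ k, k < l → ∀ W : ℕ → ℤ, ∑ i ∈ Finset.Ioc (α k) (α (k+1)), W i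
      = (∑ i ∈ Finset.Ioo (α k) (α (k+1)), W i) + W (α (k+1)) := by
    intro k hk W
    rw [← Finset.Ioo_insert_right (hlt k hk), Finset.sum_insert (by simp), add_comm]
  intro d
  induction d with
  | zero =>
    intro k hk hkd
    have hk1 : k + 1 = l := by omega
    rw [hC_split s l α V (α k) (α (k+1)) (hlt k hk).le (hle _ hk), ← hV k hk]
    have : hC s l α V (α (k+1)) = 0 := by
      rw [hk1, hl]; simp [hC]
    rw [this, add_zero]
    apply Finset.sum_congr rfl
    intro i hi
    rw [Finset.mem_Ioc] at hi
    rw [if_pos]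
    rcases Nat.lt_or_eq_of_le hi.2 with h | h
    · exact blk k hk i hi.1 h
    · rw [h, hk1, hl]
      refine ⟨le_refl _, ?_⟩
      intro r hr hr'
      have := mono_of hlt r l (by omega) le_rfl
      omega
  | succ d ih =>
    intro k hk hkd
    rw [hC_split s l α V (α k) (α (k+1)) (hlt k hk).le (hle _ hk), ← hV k hk,
      ih (k+1) (by omega) (by omega), blkS k hk, blkS k hk, if_neg, add_zero]
    · congr 1
      apply Finset.sum_congr rfl
      intro i hi
      rw [Finset.mem_Ioo] at hi
      rw [if_pos (blk k hk i hi.1 hi.2)]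
    · intro h
      exact h.2 (k+1) (by omega) (by omega) rfl

theorem dom {s l : ℕ} {α : ℕ → ℕ} (h0 : α 0 = 0) (hl1 : 1 ≤ l) (hl : α l = s)
    (hlt : ∀ k < l, α k < α (k+1)) (hle : ∀ k ≤ l, α k ≤ s) (V : ℕ → ℤ)
    (hV : ∀ k < l, ∑ i ∈ Finset.Ioc (α k) (α (k+1)), V i = V (α k)) (hpos : 0 < V 0) :
    ∃ n, 1 ≤ n ∧ hM s l α n ∧ 1 ≤ V n ∧ ∀ i < n, ¬ hM s l α i → 1 ≤ V i := by
  have hC0 : 0 < hC s l α V 0 := by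
    have := hC_alpha hl hlt hle V hV (l-1) 0 hl1 (by omega)
    rw [h0] at this; omega
  have hex : ∃ n, hC s l α V n ≤ 0 := ⟨s, by simp [hC]⟩
  classical
  set n := Nat.find hex with hn
  have hn1 : hC s l α V n ≤ 0 := Nat.find_spec hex
  have hmin : ∀ i < n, 1 ≤ hC s l α V i := by
    intro i hi
    have := Nat.find_min hex hi
    omega
  have hnpos : 1 ≤ n := by
    by_contra h
    have : n = 0 := by omega
    rw [this] at hn1; omega
  have hns : n ≤ s := Nat.find_min' hex (by simp [hC])
  have hstep := hC_split s l α V (n-1) n (by omega) hns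
  have hs1 : Finset.Ioc (n-1) n = {n} := by
    ext j; simp only [Finset.mem_Ioc, Finset.mem_singleton]; omega
  rw [hs1, Finset.sum_singleton] at hstep
  have := hmin (n-1) (by omega)
  have hnM : hM s l α n := by
    by_contra h
    rw [if_neg h] at hstep; omega
  rw [if_pos hnM] at hstep
  refine ⟨n, hnpos, hnM, by omega, ?_⟩
  intro i hi hiM
  unfold hM at hiM
  push Not at hiM
  obtain ⟨r, h1, h2, h3⟩ := hiM (by omega)
  have := hC_alpha hl hlt hle V hV (l-1-r) r (by omega) (by omega)
  rw [h3, ← this, ← h3]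
  exact hmin i hi

theorem three_le {s t : ℕ} (x : Fin (s + 1) ⊕ Fin t → ℤ) (i j k) (hij : i ≠ j) (hik : i ≠ k)
    (hjk : j ≠ k) (hi : x i ≠ 0) (hj : x j ≠ 0) (hk : x k ≠ 0) : 3 ≤ cmInner x x := by
  have h : ∑ r ∈ ({i, j, k} : Finset _), x r * x r ≤ cmInner x x :=
    Finset.sum_le_sum_of_subset_of_nonneg (Finset.subset_univ _)
      (fun r _ _ => mul_self_nonneg _)
  rw [Finset.sum_insert (by simp [hij, hik]), Finset.sum_insert (by simp [hjk]),
    Finset.sum_singleton] at h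
  have a1 := mul_self_pos.mpr hi
  have a2 := mul_self_pos.mpr hj
  have a3 := mul_self_pos.mpr hk
  omega

theorem norm_two {s t l : ℕ} {σ : ℕ → ℤ} {α : ℕ → ℕ} (h0 : α 0 = 0) (hl1 : 1 ≤ l)
    (hlt : ∀ k < l, α k < α (k+1))
    (hle : ∀ k ≤ l, α k ≤ s) (hσpos : ∀ i < t, 0 < σ i)
    (u : Fin (s + 1) ⊕ Fin t → ℤ) (hu : u ∈ cmLattice s t l σ α) (k : Fin t)
    (huk : u (Sum.inr k) = 1) (h2 : cmInner u u = 2) :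
    ∃ g : Fin t, g ≠ k ∧ σ g = σ k ∧ u (Sum.inr g) = -1 ∧
      (∀ i, u (Sum.inl i) = 0) ∧ ∀ i, i ≠ g → i ≠ k → u (Sum.inr i) = 0 := by
  have hex : ∃ j, j ≠ Sum.inr k ∧ u j ≠ 0 := by
    by_contra h
    push Not at h
    have : cmInner u u = 1 := by
      unfold cmInner
      rw [Finset.sum_eq_single (Sum.inr k)]
      · rw [huk]; rfl
      · intro b _ hb; rw [h b hb]; rfl
      · simp
    omega
  obtain ⟨j, hjk, hj⟩ := hex
  have hz : ∀ i, i ≠ Sum.inr k → i ≠ j → u i = 0 := by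
    intro i h1 h3
    by_contra h
    have := three_le u i j (Sum.inr k) h3 h1 hjk h hj (by rw [huk]; decide)
    omega
  obtain ⟨hL0, hLk⟩ := (mem_L σ α hlt hle u).mp hu
  cases j with
  | inl i =>
    exfalso
    have hs : ∑ i : Fin t, u (Sum.inr i) * σ i = σ k := by
      rw [Finset.sum_eq_single k]
      · rw [huk, one_mul]
      · intro b _ hb; rw [hz _ (by simpa using hb) (by simp), zero_mul]
      · simp
    by_cases hi : i = 0
    · subst hi
      have := hLk 0 hl1
      rw [Finset.sum_eq_zero, h0] at this
      · have h' := hX_val u 0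
        simp only [Fin.val_zero] at h'
        rw [h'] at this
        exact hj this.symm
      · intro r hr
        rw [h0, Finset.mem_Ioc] at hr
        unfold hX
        split_ifs with h
        · apply hz _ (by simp)
          intro h'
          have := congrArg Fin.val (Sum.inl.inj h')
          simp at this; omega
        · rfl
    · rw [hs, hz (Sum.inl 0) (by simp) (by simpa using Ne.symm hi)] at hL0
      have := hσpos k k.2
      omega
  | inr g =>
    have hgk : g ≠ k := by simpa using hjk
    have hs : ∑ i : Fin t, u (Sum.inr i) * σ i = u (Sum.inr g) * σ g + σ k := by
      rw [← Finset.add_sum_erase _ _ (Finset.mem_univ g), Finset.sum_eq_single k]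
      · rw [huk, one_mul]
      · intro b hb hbk; rw [hz _ (by simpa using hbk) (by simpa using (Finset.mem_erase.mp hb).1), zero_mul]
      · intro h; exact absurd (Finset.mem_erase.mpr ⟨hgk.symm, Finset.mem_univ _⟩) h
    have hn : cmInner u u = u (Sum.inr g) * u (Sum.inr g) + 1 := by
      unfold cmInner
      rw [← Finset.add_sum_erase _ _ (Finset.mem_univ (Sum.inr g)), Finset.sum_eq_single (Sum.inr k)]
      · rw [huk]; rfl
      · intro b hb hbk; rw [hz _ hbk (Finset.mem_erase.mp hb).1, zero_mul]
      · intro h; exact absurd (Finset.mem_erase.mpr ⟨hjk.symm, Finset.mem_univ _⟩) h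
    rw [hs, hz (Sum.inl 0) (by simp) (by simp)] at hL0
    have p1 := hσpos k k.2
    have p2 := hσpos g g.2
    have hm : u (Sum.inr g) = -1 := by
      have : u (Sum.inr g) * u (Sum.inr g) = 1 := by omega
      rcases mul_self_eq_one_iff.mp this with h | h
      · rw [h] at hL0; omega
      · exact h
    rw [hm] at hL0
    refine ⟨g, hgk, by omega, hm, fun i => hz _ (by simp) (by simp), ?_⟩
    intro i h1 h3
    exact hz _ (by simpa using h3) (by simpa using h1)

theorem phi_mem {s t l : ℕ} {σ : ℕ → ℤ} {α : ℕ → ℕ} (h0 : α 0 = 0) (hl : α l = s)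
    (hlt : ∀ k < l, α k < α (k+1)) (hle : ∀ k ≤ l, α k ≤ s)
    (n : ℕ) (hn : 1 ≤ n) (hnM : hM s l α n) (E : Fin t → ℤ) (hE : ∑ i, E i * σ i = -1) :
    Sum.elim (fun i : Fin (s+1) => hphi s l α n i.val) E ∈ cmLattice s t l σ α := by
  rw [mem_L σ α hlt hle]
  refine ⟨?_, ?_⟩
  · simp only [Sum.elim_inl, Sum.elim_inr, hE]
    simp [hphi]
  · intro k hk
    have hx : ∀ i ≤ s, hX (Sum.elim (fun i : Fin (s+1) => hphi s l α n i.val) E) i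
        = hphi s l α n i := by
      intro i hi
      unfold hX
      rw [dif_pos (by omega)]; rfl
    rw [hx _ (hle k hk.le), ← phi_block h0 hl hlt n hn hnM k hk]
    apply Finset.sum_congr rfl
    intro i hi
    rw [Finset.mem_Ioc] at hi
    exact hx i (by have := hle (k+1) hk; omega)

theorem e_sum {t : ℕ} (σ : ℕ → ℤ) (k : ℕ) (hk : k < t) (A : Finset ℕ) (hA : ∀ i ∈ A, i < k)
    (hs : ∑ i ∈ A, σ i = σ k - 1) :
    ∑ i : Fin t, (if i.val = k then (-1 : ℤ) else if i.val ∈ A then 1 else 0) * σ i = -1 := by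
  rw [Fin.sum_univ_eq_sum_range (fun i => (if i = k then (-1 : ℤ) else if i ∈ A then 1 else 0) * σ i)]
  have : ∀ i, (if i = k then (-1 : ℤ) else if i ∈ A then 1 else 0) * σ i
      = (if i ∈ A then σ i else 0) - (if i = k then σ i else 0) := by
    intro i
    by_cases h : i = k
    · have : k ∉ A := fun h' => lt_irrefl _ (hA k h')
      simp [h, this]
    · simp [h]
  simp only [this]
  rw [Finset.sum_sub_distrib, Finset.sum_ite_mem, Finset.sum_ite_eq',
    Finset.inter_eq_right.mpr, if_pos (Finset.mem_range.mpr hk), hs]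
  · ring
  · intro i hi
    have := hA i hi
    rw [Finset.mem_range]; omega

theorem core_s16 {s t l : ℕ} {σ : ℕ → ℤ} {α : ℕ → ℕ} (h0 : α 0 = 0) (hl1 : 1 ≤ l) (hl : α l = s)
    (hlt : ∀ k < l, α k < α (k+1)) (hle : ∀ k ≤ l, α k ≤ s) (hσpos : ∀ i < t, 0 < σ i)
    (hσmono : ∀ i j, i ≤ j → j < t → σ i ≤ σ j)
    (hσcm : Changemaker t σ)
    (v : Fin (s + 1) ⊕ Fin t → ℤ)
    (hvL : v ∈ cmLattice s t l σ α)
    (hirr : ∀ x y : Fin (s + 1) ⊕ Fin t → ℤ,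
      x ∈ cmLattice s t l σ α → y ∈ cmLattice s t l σ α →
      v = x + y → 0 ≤ cmInner x y → x = 0 ∨ y = 0)
    (hunb : ∀ x y : Fin (s + 1) ⊕ Fin t → ℤ,
      x ∈ cmLattice s t l σ α → y ∈ cmLattice s t l σ α →
      v = x + y → cmInner x y = -1 → cmInner x x = 2 ∨ cmInner y y = 2)
    (hf0 : 0 < v (Sum.inl 0)) :
    ∃ n k g, 1 ≤ n ∧ hM s l α n ∧ k ≤ g ∧ g < t ∧
      σ k = 1 + (∑ i ∈ Finset.range k, σ i) ∧ σ g = σ k ∧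
      v = Sum.elim (fun i : Fin (s + 1) => hphi s l α n i.val)
          (fun i : Fin t => if i.val = g then -1 else if i.val < k then 1 else 0) := by
  classical
  obtain ⟨hL0, hLk⟩ := (mem_L σ α hlt hle v).mp hvL
  have hV0 : hX v 0 = v (Sum.inl 0) := hX_val v 0
  obtain ⟨n, hn1, hnM, hVn, hVi⟩ := dom h0 hl1 hl hlt hle (hX v) hLk (by rw [hV0]; exact hf0)
  have hex : ∃ k, ∃ h : k < t, v (Sum.inr ⟨k, h⟩) ≤ 0 := by
    by_contra hc
    push Not at hc
    have : 0 ≤ ∑ i : Fin t, v (Sum.inr i) * σ i :=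
      Finset.sum_nonneg (fun i _ => mul_nonneg (hc i i.2).le (hσpos i i.2).le)
    omega
  set k := Nat.find hex with hkdef
  obtain ⟨hkt, hvk⟩ := Nat.find_spec hex
  have hkt : k < t := hkt
  have hvk : v (Sum.inr ⟨k, hkt⟩) ≤ 0 := hvk
  have hvi : ∀ i : Fin t, i.val < k → 1 ≤ v (Sum.inr i) := by
    intro i hi
    have := Nat.find_min hex hi
    push Not at this
    exact this i.2
  -- the subset
  have hA : ∃ A : Finset ℕ, (∀ i ∈ A, i < k) ∧ ∑ i ∈ A, σ i = σ k - 1 := by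
    have hk1 := hσpos k hkt
    rcases eq_or_lt_of_le (show (1:ℤ) ≤ σ k by omega) with h | h
    · exact ⟨∅, by simp, by simp [← h]⟩
    · have hle' : σ k ≤ ∑ i ∈ Finset.range t, σ i :=
        Finset.single_le_sum (f := σ) (fun i hi => (hσpos i (Finset.mem_range.mp hi)).le)
          (Finset.mem_range.mpr hkt)
      obtain ⟨A, hAt, hAs⟩ := hσcm (σ k - 1) (by omega) (by omega)
      refine ⟨A, ?_, hAs.symm⟩
      intro i hi
      by_contra hc
      have hit := Finset.mem_range.mp (hAt hi)
      have h1 := hσmono k i (by omega) hit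
      have h2 : σ i ≤ ∑ i ∈ A, σ i :=
        Finset.single_le_sum (f := σ)
          (fun i hi => (hσpos i (Finset.mem_range.mp (hAt hi))).le) hi
      omega
  obtain ⟨A, hAk, hAs⟩ := hA
  set z : Fin (s + 1) ⊕ Fin t → ℤ := Sum.elim (fun i : Fin (s+1) => hphi s l α n i.val)
    (fun i : Fin t => if i.val = k then (-1 : ℤ) else if i.val ∈ A then 1 else 0) with hz
  have hzL : z ∈ cmLattice s t l σ α := phi_mem h0 hl hlt hle n hn1 hnM _ (e_sum σ k hkt A hAk hAs)
  have hzk : z (Sum.inr ⟨k, hkt⟩) = -1 := by simp [hz]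
  have hz0 : z ≠ 0 := by
    intro h; rw [h] at hzk; simp at hzk
  have hvz : v = z + (v - z) := by abel
  have hyL := L_sub hvL hzL
  have hterm : ∀ j, j ≠ Sum.inr ⟨k, hkt⟩ → 0 ≤ z j * (v - z) j := by
    intro j hj
    rw [Pi.sub_apply]
    cases j with
    | inl i =>
      simp only [hz, Sum.elim_inl]
      unfold hphi
      split_ifs with h
      · have : 1 ≤ v (Sum.inl i) := by
          rw [← hX_val v i]
          rcases h with h | h | h
          · rw [h, hV0]; omega
          · rw [h]; exact hVn
          · exact hVi _ h.1 h.2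
        omega
      · simp
    | inr i =>
      have hik : i.val ≠ k := by
        intro h; apply hj; congr 1; exact Fin.ext h
      simp only [hz, Sum.elim_inr, if_neg hik]
      split_ifs with h
      · have := hvi i (hAk _ h)
        omega
      · simp
  have hsplit : cmInner z (v - z) = -(v (Sum.inr ⟨k, hkt⟩) + 1) +
      ∑ j ∈ Finset.univ.erase (Sum.inr ⟨k, hkt⟩), z j * (v - z) j := by
    unfold cmInner
    rw [← Finset.add_sum_erase _ _ (Finset.mem_univ (Sum.inr (⟨k, hkt⟩ : Fin t))), Pi.sub_apply, hzk]
    ring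
  have hrest : 0 ≤ ∑ j ∈ Finset.univ.erase (Sum.inr ⟨k, hkt⟩), z j * (v - z) j :=
    Finset.sum_nonneg (fun j hj => hterm j (Finset.mem_erase.mp hj).1)
  have fin : ∀ g, k ≤ g → g < t → σ g = σ k → (∀ i : Fin (s+1), v (Sum.inl i) = hphi s l α n i.val) →
      (∀ i : Fin t, v (Sum.inr i) = if i.val = g then -1 else if i.val ∈ A then 1 else 0) →
      ∃ n k g, 1 ≤ n ∧ hM s l α n ∧ k ≤ g ∧ g < t ∧
      σ k = 1 + (∑ i ∈ Finset.range k, σ i) ∧ σ g = σ k ∧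
      v = Sum.elim (fun i : Fin (s + 1) => hphi s l α n i.val)
          (fun i : Fin t => if i.val = g then -1 else if i.val < k then 1 else 0) := by
    intro g hkg hgt hgk hl' hr
    have hAr : A = Finset.range k := by
      ext i
      rw [Finset.mem_range]
      refine ⟨hAk i, ?_⟩
      intro hi
      by_contra hc
      have h1 := hvi ⟨i, by omega⟩ hi
      rw [hr, if_neg (by simp; omega), if_neg hc] at h1
      omega
    refine ⟨n, k, g, hn1, hnM, hkg, hgt, ?_, hgk, ?_⟩
    · rw [← hAr, hAs]; ring
    · ext j
      cases j with
      | inl i => exact hl' i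
      | inr i => rw [hr i, hAr]; simp
  by_cases hvk0 : v (Sum.inr ⟨k, hkt⟩) < 0
  · have h := hirr z (v - z) hzL hyL hvz (by rw [hsplit]; omega)
    rcases h with h | h
    · exact absurd h hz0
    · have hvz' : v = z := sub_eq_zero.mp h
      apply fin k le_rfl hkt rfl
      · intro i; rw [hvz']; rfl
      · intro i; rw [hvz']; rfl
  · have hvk1 : v (Sum.inr ⟨k, hkt⟩) = 0 := by omega
    have huk : (v - z) (Sum.inr ⟨k, hkt⟩) = 1 := by
      rw [Pi.sub_apply, hvk1, hzk]; rfl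
    have hin : cmInner z (v - z) = -1 := by
      by_contra hc
      have h := hirr z (v - z) hzL hyL hvz (by rw [hsplit] at hc ⊢; omega)
      rcases h with h | h
      · exact hz0 h
      · rw [h] at huk; simp at huk
    have h2 : cmInner (v - z) (v - z) = 2 := by
      rcases hunb z (v - z) hzL hyL hvz hin with h | h
      · exfalso
        have hns := hnM.1
        have := three_le z (Sum.inl 0) (Sum.inl ⟨n, by omega⟩) (Sum.inr ⟨k, hkt⟩)
          (by
            intro h
            have := congrArg Fin.val (Sum.inl.inj h)
            simp at this; omega) (by simp) (by simp)
          (by simp [hz, hphi]) (by simp [hz, hphi]) (by rw [hzk]; decide)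
        omega
      · exact h
    obtain ⟨g, hgk, hσg, hug, hul, hur⟩ :=
      norm_two h0 hl1 hlt hle hσpos (v - z) hyL ⟨k, hkt⟩ huk h2
    have hgk' : g.val ≠ k := fun h => hgk (Fin.ext h)
    have hgge : k ≤ g.val := by
      by_contra hc
      have h1 := hvi g (by omega)
      rw [Pi.sub_apply] at hug
      simp only [hz, Sum.elim_inr, if_neg hgk'] at hug
      split_ifs at hug <;> omega
    have hgA : g.val ∉ A := fun h => by have := hAk _ h; omega
    have hkA : k ∉ A := fun h => by have := hAk _ h; omega
    apply fin g hgge g.2 hσg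
    · intro i
      have := hul i
      rw [Pi.sub_apply] at this
      have h' : z (Sum.inl i) = hphi s l α n i.val := rfl
      omega
    · intro i
      by_cases hig : i = g
      · subst hig
        rw [Pi.sub_apply] at hug
        simp only [hz, Sum.elim_inr, if_neg hgk', if_neg hgA] at hug
        rw [if_pos rfl]; omega
      · have hig' : i.val ≠ g.val := fun h => hig (Fin.ext h)
        rw [if_neg hig']
        by_cases hik : i = ⟨k, hkt⟩
        · subst hik
          rw [hvk1, if_neg hkA]
        · have hik' : i.val ≠ k := fun h => hik (Fin.ext h)
          have := hur i hig hik
          rw [Pi.sub_apply] at this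
          simp only [hz, Sum.elim_inr, if_neg hik'] at this
          omega

theorem mu_sum_s16 {s t l m : ℕ} {α β : ℕ → ℕ} (hβ0 : β 0 = 0)
    (hβmono : ∀ i j, i < j → j ≤ m → β i < β j)
    (hβmem : ∀ n, hM s l α n ↔ ∃ i ≤ m, β i = n) (b : ℕ) (hb : b + 1 ≤ m) :
    ∑ i ∈ Finset.range (b + 1), cmMu s t β i
      = Sum.elim (fun i : Fin (s + 1) => hphi s l α (β (b+1)) i.val) (fun _ => 0) := by
  have hinv : ∀ i j, i ≤ m → β i < β j → i < j := by
    intro i j hi h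
    by_contra hc
    rcases Nat.lt_or_eq_of_le (not_lt.mp hc) with h' | h'
    · have := hβmono j i h' hi; omega
    · subst h'; omega
  have hgap : ∀ b i, b + 1 ≤ m → β b < i → i < β (b+1) → ¬ hM s l α i := by
    intro b i hb h1 h2 h
    obtain ⟨r, hr, rfl⟩ := (hβmem i).mp h
    have a1 := hinv b r (by omega) h1
    have a2 := hinv r (b+1) hr h2
    omega
  induction b with
  | zero =>
    ext j
    cases j with
    | inl i =>
      simp only [zero_add, Finset.sum_range_one, cmMu, Sum.elim_inl, hphi]
      by_cases h : i.val ≤ β 1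
      · rw [if_pos h, if_pos]
        by_cases h1 : i.val = 0
        · exact Or.inl h1
        · by_cases h2 : i.val = β 1
          · exact Or.inr (Or.inl h2)
          · exact Or.inr (Or.inr ⟨by omega, hgap 0 _ hb (by omega) (by simp; omega)⟩)
      · rw [if_neg h, if_neg]
        omega
    | inr i => simp [cmMu]
  | succ b ih =>
    rw [Finset.sum_range_succ, ih (by omega)]
    have hM1 : hM s l α (β (b+1)) := (hβmem _).mpr ⟨b+1, by omega, rfl⟩
    have m1 : β (b+1) < β (b+1+1) := hβmono (b+1) (b+1+1) (by omega) (by omega)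
    have m0 := hβmono 0 (b+1) (by omega) (by omega)
    ext j
    cases j with
    | inl i =>
      simp only [Pi.add_apply, cmMu, Sum.elim_inl, hphi]
      rcases lt_trichotomy i.val (β (b+1)) with h | h | h
      · have e : (i.val = 0 ∨ i.val = β (b+1) ∨ (i.val < β (b+1) ∧ ¬ hM s l α i.val)) ↔
            (i.val = 0 ∨ i.val = β (b+1+1) ∨ (i.val < β (b+1+1) ∧ ¬ hM s l α i.val)) := by
          constructor
          · rintro (h' | h' | h')
            · exact Or.inl h'
            · omega
            · exact Or.inr (Or.inr ⟨by omega, h'.2⟩)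
          · rintro (h' | h' | h')
            · exact Or.inl h'
            · omega
            · exact Or.inr (Or.inr ⟨by omega, h'.2⟩)
        rw [if_neg (show ¬ i.val = β (b+1) by omega), if_neg (show ¬ (β (b+1) < i.val ∧ _) by omega),
          add_zero]
        by_cases hh : (i.val = 0 ∨ i.val = β (b+1) ∨ (i.val < β (b+1) ∧ ¬ hM s l α i.val))
        · rw [if_pos hh, if_pos (e.mp hh)]
        · rw [if_neg hh, if_neg (fun h' => hh (e.mpr h'))]
      · rw [if_pos (Or.inr (Or.inl h)), if_pos h, if_neg]
        · rfl
        · rintro (h' | h' | h')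
          · omega
          · omega
          · apply h'.2; rw [h]; exact hM1
      · rw [if_neg (by omega), if_neg (by omega), zero_add]
        by_cases h2 : i.val ≤ β (b+1+1)
        · rw [if_pos ⟨h, h2⟩, if_pos]
          rcases Nat.lt_or_eq_of_le h2 with h3 | h3
          · exact Or.inr (Or.inr ⟨h3, hgap (b+1) _ hb h h3⟩)
          · exact Or.inr (Or.inl h3)
        · rw [if_neg (fun h' => h2 h'.2), if_neg (by omega)]
    | inr i => simp [cmMu]

theorem mu_norm_s16 {s t : ℕ} {β : ℕ → ℕ} (i : ℕ) (hi : 1 ≤ i) (hs : β (i+1) ≤ s)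
    (h : β (i+1) = β i + 1) :
    cmInner (cmMu s t β i) (cmMu s t β i) = 2 := by
  obtain ⟨k, rfl⟩ : ∃ k, i = k + 1 := ⟨i - 1, by omega⟩
  rw [inner_split]
  have e1 : ∑ j, cmMu s t β (k+1) (Sum.inl j) * cmMu s t β (k+1) (Sum.inl j)
      = ∑ j : Fin (s+1), (fun j : ℕ => (if j = β (k+1) then (1:ℤ) else 0) +
        (if j = β (k+2) then 1 else 0)) j.val := by
    apply Finset.sum_congr rfl
    intro j _
    simp only [cmMu]
    have h' : β (k+2) = β (k+1) + 1 := h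
    rw [h']
    split_ifs <;> first | rfl | omega
  rw [e1, Fin.sum_univ_eq_sum_range (fun j : ℕ => (if j = β (k+1) then (1:ℤ) else 0) +
        (if j = β (k+2) then 1 else 0)), Finset.sum_add_distrib, Finset.sum_ite_eq', Finset.sum_ite_eq']
  have h' : β (k+2) = β (k+1) + 1 := h
  have hs' : β (k+2) ≤ s := hs
  rw [if_pos (by simp; omega), if_pos (by simp; omega)]
  simp [cmMu]

theorem core2 {s t l m : ℕ} {σ : ℕ → ℤ} {α β : ℕ → ℕ} (h0 : α 0 = 0) (hl1 : 1 ≤ l) (hl : α l = s)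
    (hlt : ∀ k < l, α k < α (k+1)) (hle : ∀ k ≤ l, α k ≤ s) (hσpos : ∀ i < t, 0 < σ i)
    (hσmono : ∀ i j, i ≤ j → j < t → σ i ≤ σ j)
    (hσcm : Changemaker t σ)
    (hβ0 : β 0 = 0)
    (hβmono : ∀ i j, i < j → j ≤ m → β i < β j)
    (hβmem : ∀ n, hM s l α n ↔ ∃ i ≤ m, β i = n)
    (v : Fin (s + 1) ⊕ Fin t → ℤ)
    (hvL : v ∈ cmLattice s t l σ α)
    (hirr : ∀ x y : Fin (s + 1) ⊕ Fin t → ℤ,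
      x ∈ cmLattice s t l σ α → y ∈ cmLattice s t l σ α →
      v = x + y → 0 ≤ cmInner x y → x = 0 ∨ y = 0)
    (hunb : ∀ x y : Fin (s + 1) ⊕ Fin t → ℤ,
      x ∈ cmLattice s t l σ α → y ∈ cmLattice s t l σ α →
      v = x + y → cmInner x y = -1 → cmInner x x = 2 ∨ cmInner y y = 2)
    (hf0 : 0 < v (Sum.inl 0)) :
    ∃ (k g b : ℕ), k ≤ g ∧ g < t ∧
      σ k = 1 + (∑ i ∈ Finset.range k, σ i) ∧ σ g = σ k ∧ b ≤ m - 1 ∧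
      v = (Sum.elim (fun _ : Fin (s + 1) => (0 : ℤ))
          (fun i : Fin t => if i.val = g then -1 else if i.val < k then 1 else 0))
        + (∑ i ∈ Finset.range (b + 1), cmMu s t β i) ∧
      (∀ i, 1 ≤ i → i ≤ b → cmInner (cmMu s t β i) (cmMu s t β i) = 2) := by
  obtain ⟨n, k, g, hn1, hnM, hkg, hgt, htight, hσg, hv⟩ :=
    core_s16 h0 hl1 hl hlt hle hσpos hσmono hσcm v hvL hirr hunb hf0
  obtain ⟨c, hcm, hc⟩ := (hβmem n).mp hnM
  obtain ⟨b, rfl⟩ : ∃ b, c = b + 1 := by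
    refine ⟨c - 1, ?_⟩
    have : c ≠ 0 := by rintro rfl; omega
    omega
  refine ⟨k, g, b, hkg, hgt, htight, hσg, by omega, ?_, ?_⟩
  · rw [mu_sum_s16 hβ0 hβmono hβmem b hcm, hv, hc]
    ext j
    cases j <;> simp
  · intro i hi1 hib
    have hiM : hM s l α (β i) := (hβmem _).mpr ⟨i, by omega, rfl⟩
    have hi0 := hβmono 0 i (by omega) (by omega)
    have hin : β i < n := by rw [← hc]; exact hβmono _ _ (by omega) hcm
    have hi1M : hM s l α (β (i+1)) := (hβmem _).mpr ⟨i+1, by omega, rfl⟩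
    have hii := hβmono i (i+1) (by omega) (by omega)
    apply mu_norm_s16 i hi1 hi1M.1
    by_contra hne
    have hgapM : ¬ hM s l α (β i + 1) := by
      intro h
      obtain ⟨r, hr, hr'⟩ := (hβmem _).mp h
      rcases Nat.lt_trichotomy r i with h | h | h
      · have := hβmono r i h (by omega); omega
      · subst h; omega
      · rcases Nat.lt_or_eq_of_le (Nat.succ_le_of_lt h) with h | h
        · have := hβmono (i+1) r h hr; omega
        · rw [← h] at hr'; exact hne hr'
    set E : Fin t → ℤ := (fun i : Fin t => if i.val = g then -1 else if i.val < k then 1 else 0)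
      with hE
    have hin1 : β i + 1 < n := by
      have : β (i+1) ≤ n := by
        rw [← hc]
        rcases Nat.lt_or_eq_of_le hib with h | h
        · exact (hβmono (i+1) (b+1) (by omega) hcm).le
        · rw [h]
      omega
    have hEs : ∑ i, E i * σ i = -1 := by
      have := ((mem_L σ α hlt hle v).mp hvL).1
      rw [hv] at this
      simp only [Sum.elim_inl, Sum.elim_inr] at this
      have h1 : hphi s l α n (0 : Fin (s+1)).val = 1 := by simp [hphi]
      rw [h1] at this
      omega
    set x : Fin (s + 1) ⊕ Fin t → ℤ := Sum.elim (fun j : Fin (s+1) => hphi s l α (β i) j.val) E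
      with hx
    have hxL : x ∈ cmLattice s t l σ α := phi_mem h0 hl hlt hle (β i) (by omega) hiM E hEs
    have hyL := L_sub hvL hxL
    have hns := hnM.1
    have hbs : β i < s + 1 := by omega
    have hyl : ∀ j : Fin (s+1), (v - x) (Sum.inl j) = hphi s l α n j.val - hphi s l α (β i) j.val := by
      intro j; rw [Pi.sub_apply, hv]; rfl
    have hyr : ∀ j : Fin t, (v - x) (Sum.inr j) = 0 := by
      intro j; rw [Pi.sub_apply, hv]; exact sub_self _
    have p1 : hphi s l α n (β i) = 0 := by
      rw [hphi, if_neg]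
      rintro (h | h | h)
      · omega
      · omega
      · exact h.2 hiM
    have p2 : hphi s l α (β i) (β i) = 1 := by simp [hphi]
    have p3 : hphi s l α n n = 1 := by simp [hphi]
    have p4 : hphi s l α (β i) n = 0 := by
      rw [hphi, if_neg]; omega
    have p5 : hphi s l α n (β i + 1) = 1 := by
      rw [hphi, if_pos]; exact Or.inr (Or.inr ⟨hin1, hgapM⟩)
    have p6 : hphi s l α (β i) (β i + 1) = 0 := by
      rw [hphi, if_neg]; omega
    have hinner : cmInner x (v - x) = -1 := by
      unfold cmInner
      rw [Finset.sum_eq_single (Sum.inl ⟨β i, hbs⟩)]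
      · rw [hyl, p1]
        simp only [hx, Sum.elim_inl, p2]
        rfl
      · intro j _ hj
        cases j with
        | inl j =>
          rw [hyl]
          have hj' : j.val ≠ β i := by
            intro h; apply hj; congr 1; exact Fin.ext h
          simp only [hx, Sum.elim_inl]
          by_cases hcase : j.val = 0 ∨ (j.val < β i ∧ ¬ hM s l α j.val)
          · have : hphi s l α n j.val = hphi s l α (β i) j.val := by
              rw [hphi, hphi, if_pos, if_pos]
              · rcases hcase with h | h
                · exact Or.inl h
                · exact Or.inr (Or.inr h)
              · rcases hcase with h | h
                · exact Or.inl h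
                · exact Or.inr (Or.inr ⟨by omega, h.2⟩)
            rw [this, sub_self, mul_zero]
          · have : hphi s l α (β i) j.val = 0 := by
              rw [hphi, if_neg]
              rintro (h | h | h)
              · exact hcase (Or.inl h)
              · exact hj' h
              · exact hcase (Or.inr h)
            rw [this, zero_mul]
        | inr j => rw [hyr, mul_zero]
      · simp
    have finne : ∀ (a c : ℕ) (ha : a < s + 1) (hc : c < s + 1), a ≠ c →
        (Sum.inl ⟨a, ha⟩ : Fin (s+1) ⊕ Fin t) ≠ Sum.inl ⟨c, hc⟩ := by
      intro a c ha hc hac h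
      exact hac (congrArg Fin.val (Sum.inl.inj h))
    rcases hunb x (v - x) hxL hyL (by abel) hinner with h | h
    · have := three_le x (Sum.inl ⟨0, by omega⟩) (Sum.inl ⟨β i, hbs⟩) (Sum.inr ⟨g, hgt⟩)
        (finne _ _ _ _ (by omega)) (by simp) (by simp)
        (by simp [hx, hphi]) (by simp [hx, hphi]) (by simp [hx, hE])
      omega
    · have := three_le (v - x) (Sum.inl ⟨β i, hbs⟩) (Sum.inl ⟨n, by omega⟩)
        (Sum.inl ⟨β i + 1, by omega⟩)
        (finne _ _ _ _ (by omega)) (finne _ _ _ _ (by omega)) (finne _ _ _ _ (by omega))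
        (by rw [hyl]; simp only [p1, p2]; decide) (by rw [hyl]; simp only [p3, p4]; decide)
        (by rw [hyl]; simp only [p5, p6]; decide)
      omega

/-- Structure of irreducible unbreakable vectors of a `p/q`-changemaker lattice
(`q > 1`) pairing non-trivially with `f_0`:  up to sign, such a vector is
`−e_g + e_{k−1} + … + e_1 + μ_0 + … + μ_b` where `σ_k` is tight, `σ_g = σ_k`
(with `k ≤ g ≤ t`), `0 ≤ b ≤ m − 1`, and `‖μ_i‖ = 2` for `1 ≤ i ≤ b`.
In the 0-indexed conventions used here (`σ i`, `e`-coordinate `Sum.inr i`,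
`cmNu … k` representing `σ_{i+1}`, `e_{i+1}`, `ν_{k+1}` respectively), the paper's
indices `k, g ∈ {1, …, t}` become `k, g ∈ {0, …, t−1}` with `k ≤ g < t`, and the
`e`-part of the vector is `−e_g + Σ_{i<k} e_i`. -/
theorem stmt_16
    (p q : ℕ) (hp : 0 < p) (hq : 1 < q) (hpq : Nat.Coprime p q)
    (l : ℕ) (hl : 1 ≤ l)
    (a : ℕ → ℕ) (ha0 : 1 ≤ a 0) (ha : ∀ i, 1 ≤ i → i ≤ l → 2 ≤ a i)
    (hcf : negCF (fun i => (a i : ℤ)) (l + 1) = (p : ℚ) / q)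
    (s : ℕ) (hs : s = ∑ i ∈ Finset.Icc 1 l, (a i - 1))
    (α : ℕ → ℕ) (hα : ∀ k, α k = ∑ i ∈ Finset.Icc 1 k, (a i - 1))
    (t : ℕ) (ht : 1 ≤ t)
    (σ : ℕ → ℤ) (hσpos : ∀ i < t, 0 < σ i)
    (hσmono : ∀ i j, i ≤ j → j < t → σ i ≤ σ j)
    (hσcm : Changemaker t σ)
    (hσnorm : 1 + ∑ i ∈ Finset.range t, σ i ^ 2 = (a 0 : ℤ))
    (m : ℕ) (β : ℕ → ℕ)
    (hβ0 : β 0 = 0) (hβm : β m = s)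
    (hβmono : ∀ i j, i < j → j ≤ m → β i < β j)
    (hβmem : ∀ n, (n ≤ s ∧ ∀ k, 1 ≤ k → k ≤ l - 1 → n ≠ α k) ↔ ∃ i ≤ m, β i = n)
    (v : Fin (s + 1) ⊕ Fin t → ℤ)
    (hvL : v ∈ cmLattice s t l σ α)
    (hirr : ∀ x y : Fin (s + 1) ⊕ Fin t → ℤ,
      x ∈ cmLattice s t l σ α → y ∈ cmLattice s t l σ α →
      v = x + y → 0 ≤ cmInner x y → x = 0 ∨ y = 0)
    (hunb : ∀ x y : Fin (s + 1) ⊕ Fin t → ℤ,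
      x ∈ cmLattice s t l σ α → y ∈ cmLattice s t l σ α →
      v = x + y → cmInner x y = -1 → cmInner x x = 2 ∨ cmInner y y = 2)
    (hf0 : v (Sum.inl 0) ≠ 0) :
    ∃ (ε : ℤ) (k g b : ℕ), (ε = 1 ∨ ε = -1) ∧ k ≤ g ∧ g < t ∧
      σ k = 1 + (∑ i ∈ Finset.range k, σ i) ∧ σ g = σ k ∧ b ≤ m - 1 ∧
      ε • v = (Sum.elim (fun _ : Fin (s + 1) => (0 : ℤ))
          (fun i : Fin t => if i.val = g then -1 else if i.val < k then 1 else 0))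
        + (∑ i ∈ Finset.range (b + 1), cmMu s t β i) ∧
      (∀ i, 1 ≤ i → i ≤ b → cmInner (cmMu s t β i) (cmMu s t β i) = 2) := by
  have h0 : α 0 = 0 := by rw [hα]; simp
  have hαl : α l = s := by rw [hα, hs]
  have hlt : ∀ k < l, α k < α (k+1) := by
    intro k hk
    rw [hα, hα, Finset.sum_Icc_succ_top (by omega)]
    have := ha (k+1) (by omega) (by omega)
    omega
  have hle : ∀ k ≤ l, α k ≤ s := by
    intro k hk
    rcases Nat.lt_or_eq_of_le hk with h | h
    · have := mono_of hlt k l h le_rfl; omega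
    · rw [h, hαl]
  rcases lt_or_gt_of_ne hf0 with hneg | hpos
  · have hi' : ∀ x y : Fin (s + 1) ⊕ Fin t → ℤ, cmInner (-x) (-y) = cmInner x y := by
      intro x y; simp [cmInner]
    obtain ⟨k, g, b, h1, h2, h3, h4, h5, h6, h7⟩ :=
      core2 (m := m) (β := β) h0 hl hαl hlt hle hσpos hσmono hσcm hβ0 hβmono hβmem (-v) (L_neg hvL)
      (by
        intro x y hx hy hxy hin
        have := hirr (-x) (-y) (L_neg hx) (L_neg hy)
          (by rw [← neg_add, ← hxy, neg_neg]) (by rw [hi']; exact hin)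
        simpa using this)
      (by
        intro x y hx hy hxy hin
        have := hunb (-x) (-y) (L_neg hx) (L_neg hy)
          (by rw [← neg_add, ← hxy, neg_neg]) (by rw [hi']; exact hin)
        simpa only [hi'] using this)
      (by rw [Pi.neg_apply]; omega)
    exact ⟨-1, k, g, b, Or.inr rfl, h1, h2, h3, h4, h5, by rw [← h6, neg_one_smul], h7⟩
  · obtain ⟨k, g, b, h1, h2, h3, h4, h5, h6, h7⟩ :=
      core2 (m := m) (β := β) h0 hl hαl hlt hle hσpos hσmono hσcm hβ0 hβmono hβmem v hvL
        hirr hunb hpos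
    exact ⟨1, k, g, b, Or.inl rfl, h1, h2, h3, h4, h5, by rw [← h6, one_smul], h7⟩
end

section
/- Let p, q be coprime positive integers with q > 1, write p/q = [a_0, a_1, …, a_l]⁻ with a_0 ≥ 1 and a_i ≥ 2 for i ≥ 1, and set r = a_0·q − p (so 1 ≤ r < q). With μ_0, μ_1, …, μ_{m−1} defined as below, the negative continued fraction of their norms satisfies [‖μ_0‖, ‖μ_1‖, …, ‖μ_{m−1}‖]⁻ = q/(q − r), where ‖μ_k‖ = μ_k·μ_k. -/
theorem negCF_congr' : ∀ (n : ℕ) (a b : ℕ → ℤ), (∀ i < n, a i = b i) → negCF a n = negCF b n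
  | 0, _, _, _ => rfl
  | 1, a, b, h => by simp [negCF, h 0]
  | n + 2, a, b, h => by
    have := negCF_congr' (n + 1) (fun i => a (i + 1)) (fun i => b (i + 1))
      (fun i hi => h (i + 1) (by omega))
    simp only [negCF, this, h 0 (by omega)]

def gapSeq (A : ℕ → ℕ) : ℕ → ℤ := fun i => (A (i + 1) : ℤ) - A i + 1

def Cmp (s l m : ℕ) (A B : ℕ → ℕ) : Prop :=
  A 0 = 0 ∧ B 0 = 0 ∧ A l = s ∧ B m = s ∧
  (∀ i j, i < j → j ≤ l → A i < A j) ∧ (∀ i j, i < j → j ≤ m → B i < B j) ∧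
  (∀ n, 0 < n → n < s → ((∃ i ≤ l, A i = n) ↔ ¬ ∃ i ≤ m, B i = n))

def Concl (l m : ℕ) (A B : ℕ → ℕ) : Prop :=
  1 < negCF (gapSeq A) l ∧ 1 < negCF (gapSeq B) m ∧
    negCF (gapSeq A) l + negCF (gapSeq B) m = negCF (gapSeq A) l * negCF (gapSeq B) m

theorem Cmp.symm {s l m A B} (h : Cmp s l m A B) : Cmp s m l B A := by
  obtain ⟨h1, h2, h3, h4, h5, h6, h7⟩ := h
  refine ⟨h2, h1, h4, h3, h6, h5, fun n a b => ?_⟩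
  rw [h7 n a b, not_not]

theorem Concl.symm {l m A B} (h : Concl l m A B) : Concl m l B A := by
  obtain ⟨h1, h2, h3⟩ := h
  exact ⟨h2, h1, by linarith⟩

theorem step (s : ℕ) (hs : 1 ≤ s) (ih : ∀ l m A B, Cmp s l m A B → Concl l m A B)
    (l m A B) (h : Cmp (s + 1) l m A B) (h1 : ∃ i ≤ l, A i = 1) : Concl l m A B := by
  obtain ⟨hA0, hB0, hAl, hBm, hA, hB, hc⟩ := h
  have hnB := (hc 1 (by omega) (by omega)).1 h1
  obtain ⟨i, hi, hi1⟩ := h1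
  have hi' : i = 1 := by
    rcases Nat.lt_trichotomy i 1 with h | h | h
    · have : i = 0 := by omega
      subst this; omega
    · exact h
    · have := hA 0 1 (by omega) (by omega)
      have := hA 1 i h hi
      omega
  subst hi'
  obtain ⟨l, rfl⟩ : ∃ l', l = l' + 2 := by
    refine ⟨l - 2, ?_⟩
    by_contra hh
    have : l = 1 := by omega
    subst this; omega
  obtain ⟨m, rfl⟩ : ∃ m', m = m' + 1 := by
    refine ⟨m - 1, ?_⟩
    by_contra hh
    have : m = 0 := by omega
    subst this; omega
  have hBpos : ∀ j, 0 < j → j ≤ m + 1 → 2 ≤ B j := by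
    intro j hj hjm
    have := hB 0 j hj hjm
    have : B j ≠ 1 := fun hh => hnB ⟨j, hjm, hh⟩
    omega
  have hApos : ∀ j, 0 < j → j ≤ l + 2 → 1 ≤ A j := by
    intro j hj hjm
    have := hA 0 j hj hjm
    omega
  have key : Cmp s (l + 1) (m + 1) (fun i => A (i + 1) - 1) (fun i => B i - 1) := by
    refine ⟨by simp [hi1], by simp [hB0], by simp [hAl], by simp [hBm], ?_, ?_, ?_⟩
    · intro i j hij hj
      have := hA (i + 1) (j + 1) (by omega) (by omega)
      have := hApos (i + 1) (by omega) (by omega)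
      simp only; omega
    · intro i j hij hj
      have := hB i j (by omega) (by omega)
      have := hBpos j (by omega) (by omega)
      simp only; omega
    · intro n hn hns
      have e1 : (∃ i ≤ l + 1, A (i + 1) - 1 = n) ↔ ∃ i ≤ l + 2, A i = n + 1 := by
        constructor
        · rintro ⟨i, hi, h⟩
          exact ⟨i + 1, by omega, by omega⟩
        · rintro ⟨i, hi, h⟩
          have : i ≠ 0 := by rintro rfl; omega
          refine ⟨i - 1, by omega, ?_⟩
          rw [Nat.sub_add_cancel (by omega)]; omega
      have e2 : (∃ i ≤ m + 1, B i - 1 = n) ↔ ∃ i ≤ m + 1, B i = n + 1 := by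
        constructor
        · rintro ⟨i, hi, h⟩
          exact ⟨i, by omega, by omega⟩
        · rintro ⟨i, hi, h⟩
          exact ⟨i, by omega, by omega⟩
      simp only
      rw [e1, e2]
      exact hc (n + 1) (by omega) (by omega)
  obtain ⟨c1, c2, c3⟩ := ih _ _ _ _ key
  have eA : negCF (gapSeq A) (l + 2) =
      2 - 1 / negCF (gapSeq (fun i => A (i + 1) - 1)) (l + 1) := by
    have : negCF (gapSeq (fun i => A (i + 1) - 1)) (l + 1)
        = negCF (fun i => gapSeq A (i + 1)) (l + 1) := by
      apply negCF_congr'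
      intro i hi
      have := hApos (i + 1) (by omega) (by omega)
      have := hApos (i + 2) (by omega) (by omega)
      simp only [gapSeq]
      push_cast [Nat.cast_sub, *]
      ring
    rw [this]
    simp only [negCF, gapSeq, hA0, hi1]
    norm_num
  have eB : negCF (gapSeq B) (m + 1) = negCF (gapSeq (fun i => B i - 1)) (m + 1) + 1 := by
    have g0 : gapSeq B 0 = gapSeq (fun i => B i - 1) 0 + 1 := by
      have := hBpos (0 + 1) (by omega) (by omega)
      simp only [gapSeq, hB0]
      omega
    cases m with
    | zero => simp [negCF, g0]
    | succ m =>
      have : negCF (fun i => gapSeq (fun i => B i - 1) (i + 1)) (m + 1)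
          = negCF (fun i => gapSeq B (i + 1)) (m + 1) := by
        apply negCF_congr'
        intro i hi
        have := hBpos (i + 1) (by omega) (by omega)
        have := hBpos (i + 1 + 1) (by omega) (by omega)
        simp only [gapSeq]
        omega
      simp only [negCF, this, g0]
      push_cast
      ring
  unfold Concl
  rw [eA, eB]
  generalize negCF (gapSeq (fun i => A (i + 1) - 1)) (l + 1) = X at *
  generalize negCF (gapSeq (fun i => B i - 1)) (m + 1) = Y at *
  have hX : 1 / X < 1 := by rw [div_lt_one (by linarith)]; exact c1
  refine ⟨by linarith, by linarith, ?_⟩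
  have : X ≠ 0 := by linarith
  field_simp
  linarith

theorem mainCF (s : ℕ) (hs : 1 ≤ s) : ∀ l m A B, Cmp s l m A B → Concl l m A B := by
  induction s, hs using Nat.le_induction with
  | base =>
    have one : ∀ l A, A 0 = 0 → A l = 1 → (∀ i j, i < j → j ≤ l → A i < A j) →
        negCF (gapSeq A) l = 2 := by
      intro l A h0 h1 h
      have : l = 1 := by
        have : l ≠ 0 := by rintro rfl; omega
        by_contra hh
        have := h 0 1 (by omega) (by omega)
        have := h 1 l (by omega) (by omega)
        omega
      subst this
      norm_num [negCF, gapSeq, h0, h1]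
    rintro l m A B ⟨h1, h2, h3, h4, h5, h6, h7⟩
    unfold Concl
    rw [one l A h1 h3 h5, one m B h2 h4 h6]
    norm_num
  | succ s hs ih =>
    intro l m A B h
    by_cases h1 : ∃ i ≤ l, A i = 1
    · exact step s hs ih l m A B h h1
    · refine (step s hs ih m l B A h.symm ?_).symm
      have := h.2.2.2.2.2.2 1 (by omega) (by omega)
      by_contra h2
      exact h1 (this.2 h2)

theorem count_aux (s u v : ℕ) (huv : u ≤ v) (hv : v ≤ s) :
    (∑ i : Fin (s + 1), if u ≤ i.val ∧ i.val ≤ v then (1 : ℤ) else 0) = (v : ℤ) - u + 1 := by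
  rw [Fin.sum_univ_eq_sum_range (fun i => if u ≤ i ∧ i ≤ v then (1 : ℤ) else 0) (s + 1),
    Finset.sum_boole]
  have : Finset.filter (fun i => u ≤ i ∧ i ≤ v) (Finset.range (s + 1)) = Finset.Icc u v := by
    ext i; simp; omega
  rw [this, Nat.card_Icc]
  omega

theorem norm_mu (s t m : ℕ) (β : ℕ → ℕ) (h0 : β 0 = 0) (hm : β m = s)
    (hmono : ∀ i j, i < j → j ≤ m → β i < β j) (k : ℕ) (hk : k < m) :
    cmInner (cmMu s t β k) (cmMu s t β k) = gapSeq β k := by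
  have hle : β (k + 1) ≤ s := by
    rcases Nat.lt_or_ge (k + 1) m with h | h
    · have := hmono _ _ h le_rfl; omega
    · have : k + 1 = m := by omega
      rw [this, hm]
  have hlt := hmono k (k + 1) (by omega) (by omega)
  unfold gapSeq
  rw [← count_aux s _ _ hlt.le hle]
  unfold cmInner
  rw [Fintype.sum_sum_type]
  cases k with
  | zero =>
    simp only [cmMu, mul_zero, Finset.sum_const_zero, add_zero]
    refine Finset.sum_congr rfl fun i _ => ?_
    have e : β (0 + 1) = β 1 := rfl
    split_ifs <;> first | rfl | omega
  | succ k =>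
    simp only [cmMu, mul_zero, Finset.sum_const_zero, add_zero]
    refine Finset.sum_congr rfl fun i _ => ?_
    have e : β (k + 1 + 1) = β (k + 2) := rfl
    split_ifs <;> first | rfl | omega

/-- With `p/q = [a_0, a_1, …, a_l]⁻` (`q > 1`, `a_0 ≥ 1`, `a_i ≥ 2` for `i ≥ 1`) and
`r = a_0·q − p`, one has `1 ≤ r < q`, and the norms of the vectors
`μ_0, μ_1, …, μ_{m−1}` satisfy `[‖μ_0‖, ‖μ_1‖, …, ‖μ_{m−1}‖]⁻ = q/(q − r)`. -/
theorem stmt_17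
    (p q : ℕ) (hp : 0 < p) (hq : 1 < q) (hpq : Nat.Coprime p q)
    (l : ℕ) (hl : 1 ≤ l)
    (a : ℕ → ℕ) (ha0 : 1 ≤ a 0) (ha : ∀ i, 1 ≤ i → i ≤ l → 2 ≤ a i)
    (hcf : negCF (fun i => (a i : ℤ)) (l + 1) = (p : ℚ) / q)
    (s : ℕ) (hs : s = ∑ i ∈ Finset.Icc 1 l, (a i - 1))
    (α : ℕ → ℕ) (hα : ∀ k, α k = ∑ i ∈ Finset.Icc 1 k, (a i - 1))
    (t : ℕ)
    (m : ℕ) (hm : 1 ≤ m) (β : ℕ → ℕ)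
    (hβ0 : β 0 = 0) (hβm : β m = s)
    (hβmono : ∀ i j, i < j → j ≤ m → β i < β j)
    (hβmem : ∀ n, (n ≤ s ∧ ∀ k, 1 ≤ k → k ≤ l - 1 → n ≠ α k) ↔ ∃ i ≤ m, β i = n) :
    (1 ≤ (a 0 : ℤ) * q - p ∧ (a 0 : ℤ) * q - p < q) ∧
    negCF (fun i => cmInner (cmMu s t β i) (cmMu s t β i)) m
      = (q : ℚ) / ((q : ℚ) - ((a 0 : ℚ) * q - p)) := by
  have hαs : ∀ k, α (k + 1) = α k + (a (k + 1) - 1) := by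
    intro k
    rw [hα, hα, Finset.sum_Icc_succ_top (by omega)]
  have hα0 : α 0 = 0 := by simp [hα]
  have hαl : α l = s := by rw [hα, hs]
  have hαmono : ∀ i j, i < j → j ≤ l → α i < α j := by
    intro i j hij
    induction j, hij using Nat.le_induction with
    | base =>
      intro h
      have := ha (i + 1) (by omega) h
      have := hαs i
      simp only [Nat.succ_eq_add_one]
      omega
    | succ j hj ih =>
      intro h
      have := ih (by omega)
      have := ha (j + 1) (by omega) h
      have := hαs j
      omega
  have hs1 : 1 ≤ s := by
    have := hαmono 0 l (by omega) le_rfl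
    omega
  have hC : Cmp s l m α β := by
    refine ⟨hα0, hβ0, hαl, hβm, hαmono, hβmono, ?_⟩
    intro n hn hns
    rw [← hβmem n]
    constructor
    · rintro ⟨i, hi, rfl⟩ ⟨-, h⟩
      have : i ≠ 0 := by rintro rfl; omega
      have : i ≠ l := by rintro rfl; omega
      exact h i (by omega) (by omega) rfl
    · intro h
      by_contra hh
      apply h
      refine ⟨by omega, fun k h1 h2 h3 => hh ⟨k, by omega, h3.symm⟩⟩
  obtain ⟨c1, c2, c3⟩ := mainCF s hs1 _ _ _ _ hC
  rw [negCF_congr' m _ (gapSeq β) (norm_mu s t m β hβ0 hβm hβmono)]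
  obtain ⟨l, rfl⟩ : ∃ l', l = l' + 1 := ⟨l - 1, by omega⟩
  have e : negCF (fun i => (a (i + 1) : ℤ)) (l + 1) = negCF (gapSeq α) (l + 1) := by
    apply negCF_congr'
    intro i hi
    have := ha (i + 1) (by omega) (by omega)
    have := hαs i
    simp only [gapSeq]
    omega
  simp only [negCF] at hcf
  rw [e] at hcf
  generalize negCF (gapSeq α) (l + 1) = X at *
  generalize negCF (gapSeq β) m = Y at *
  have hq0 : (0 : ℚ) < q := by exact_mod_cast (by omega : 0 < q)
  have hX0 : (0 : ℚ) < X := by linarith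
  have hr : ((a 0 : ℚ) * q - p) * X = q := by
    push_cast at hcf
    field_simp at hcf
    linarith
  have r1 : (0 : ℚ) < (a 0 : ℚ) * q - p := by
    by_contra hh
    nlinarith
  have r2 : (a 0 : ℚ) * q - p < q := by nlinarith
  refine ⟨⟨?_, ?_⟩, ?_⟩
  · have : (0 : ℤ) < (a 0 : ℤ) * q - p := by exact_mod_cast r1
    omega
  · exact_mod_cast r2
  · rw [eq_div_iff (by linarith)]
    have : ((a 0 : ℚ) * q - p) ≠ 0 := r1.ne'
    generalize (a 0 : ℚ) * q - p = r at *
    rw [← hr]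
    linear_combination (-r) * c3
end
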